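/- arXiv:0806.1878 — 2 statements merged into one kernel-verified Lean document; each statement's English description precedes it below -/
import Mathlib

section
/- For every τ in the complex upper half-plane with q = e^{2πiτ}, and every nonzero complex number w with w ≠ q^n for all integers n, one has g_2(w;q) = ((−q;q)_∞/(q;q)_∞) · Σ_{n∈ℤ} (−1)^n q^{n(n+1)}/(1 − w q^n). -/
open Complex

noncomputable section

/-- Finite q-Pochhammer symbol `(a;q)_n`. -/
def qPoch (a q : ℂ) (n : ℕ) : ℂ := ∏ j ∈ Finset.range n, (1 - a * q ^ j)

/-- Infinite q-Pochhammer symbol `(a;q)_∞`. -/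
def qPochInf (a q : ℂ) : ℂ := ∏' j : ℕ, (1 - a * q ^ j)

/-- Jacobi theta function `θ(z;τ)`. -/
def theta (z τ : ℂ) : ℂ :=
  ∑' n : ℤ, (-1 : ℂ) ^ n * Complex.exp (Real.pi * Complex.I * (2 * n + 1) * z) *
    Complex.exp (2 * Real.pi * Complex.I * τ * ((n : ℂ) * (n + 1) / 2 + 1 / 8))

/-- Zwegers' mock Jacobi form `μ(u,v;τ)`. -/
def mu (u v τ : ℂ) : ℂ :=
  Complex.exp (Real.pi * Complex.I * u) / theta v τ *
    ∑' n : ℤ, (-Complex.exp (2 * Real.pi * Complex.I * v)) ^ n *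
      Complex.exp (Real.pi * Complex.I * τ * n * (n + 1)) /
      (1 - Complex.exp (2 * Real.pi * Complex.I * u) *
        Complex.exp (2 * Real.pi * Complex.I * τ) ^ n)

/-- Dedekind eta function `η(τ)`. -/
def eta (τ : ℂ) : ℂ :=
  Complex.exp (Real.pi * Complex.I * τ / 12) *
    ∏' n : ℕ, (1 - Complex.exp (2 * Real.pi * Complex.I * τ * (n + 1)))

/-- Universal mock theta function `g₂(w;q)`. -/
def g2 (w q : ℂ) : ℂ :=
  ∑' n : ℕ, qPoch (-q) q n * q ^ (n * (n + 1) / 2) /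
    (qPoch w q (n + 1) * qPoch (q / w) q (n + 1))

/-- Universal mock theta function `g₃(w;q)`. -/
def g3 (w q : ℂ) : ℂ :=
  ∑' n : ℕ, q ^ (n * (n + 1)) / (qPoch w q (n + 1) * qPoch (q / w) q (n + 1))

/-- Rank generating function `𝓡(w;q)`. -/
def rankGF (w q : ℂ) : ℂ :=
  ∑' n : ℕ, q ^ (n ^ 2) / ∏ k ∈ Finset.range n, ((1 - w * q ^ (k + 1)) * (1 - q ^ (k + 1) / w))

/-- Crank generating function `𝓒(w;q)`. -/
def crankGF (w q : ℂ) : ℂ := qPochInf q q / (qPochInf (w * q) q * qPochInf (q / w) q)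

/-- The series `K'(w;τ)` with `q = e^{2πiτ}`. -/
def Kp (w q : ℂ) : ℂ :=
  ∑' n : ℕ, (-1 : ℂ) ^ n * q ^ (n ^ 2) * qPoch q (q ^ 2) n /
    (qPoch (w * q ^ 2) (q ^ 2) n * qPoch (q ^ 2 / w) (q ^ 2) n)

/-- The series `K''(w;τ)` with `q = e^{2πiτ}` (the sum starts at `n = 1`). -/
def Kpp (w q : ℂ) : ℂ :=
  ∑' n : ℕ, (-1 : ℂ) ^ (n + 1) * q ^ ((n + 1) ^ 2) * qPoch q (q ^ 2) n /
    (qPoch (w * q) (q ^ 2) (n + 1) * qPoch (q / w) (q ^ 2) (n + 1))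

/-- The series `ρ(a,b,c)` from the three variable reciprocity theorem. -/
def rho (a b c q : ℂ) : ℂ :=
  (1 + 1 / b) * ∑' n : ℕ, qPoch c q n * (-1 : ℂ) ^ n * q ^ (n * (n + 1) / 2) * (a / b) ^ n /
    (qPoch (-a * q) q n * qPoch (-c / b) q (n + 1))

theorem qPoch_succ (a q : ℂ) (n : ℕ) : qPoch a q (n + 1) = qPoch a q n * (1 - a * q ^ n) := by
  simp [qPoch, Finset.prod_range_succ]

@[simp] theorem qPoch_zero (a q : ℂ) : qPoch a q 0 = 1 := by
  simp [qPoch]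

theorem qPoch_ne_zero {a q : ℂ} (h : ∀ j : ℕ, 1 - a * q ^ j ≠ 0) (n : ℕ) : qPoch a q n ≠ 0 :=
  Finset.prod_ne_zero_iff.mpr fun j _ => h j

theorem pow_triangle_succ (q : ℂ) (n : ℕ) :
    q ^ ((n + 1) * (n + 1 + 1) / 2) = q ^ (n * (n + 1) / 2) * q ^ (n + 1) := by
  rw [← pow_add]
  congr 1
  rw [show (n + 1) * (n + 1 + 1) = n * (n + 1) + (n + 1) * 2 by ring,
    Nat.add_mul_div_right _ _ two_pos]

/-- The coefficients in the partial fraction expansion of `1 / ((A;q)_{n+1} (q/A;q)_{n+1})`. -/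
def qPochCoeff (q : ℂ) (n r : ℕ) : ℂ :=
  (-1) ^ r * q ^ (r * (r + 1) / 2) * (1 - q ^ (2 * r + 1)) /
    (qPoch q q (n - r) * qPoch q q (n + r + 1))

theorem sum_qPochCoeff_div_pow_range {q : ℂ} (hq0 : q ≠ 0) (hq : ∀ j : ℕ, 1 - q * q ^ j ≠ 0)
    (n R : ℕ) (hR : R ≤ n + 1) :
    ∑ r ∈ Finset.range R, qPochCoeff q (n + 1) r / q ^ r =
      (-1) ^ (R + 1) * (q ^ (R * (R + 1) / 2) / q ^ R) * (1 - q ^ R) /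
        ((1 - q ^ (n + 1)) * qPoch q q (n + 1 - R) * qPoch q q (n + 1 + R)) := by
  induction R with
  | zero => simp
  | succ R ih =>
    obtain ⟨d, rfl⟩ : ∃ d, n = R + d := ⟨n - R, by omega⟩
    rw [Finset.sum_range_succ, ih (by omega), qPochCoeff, pow_triangle_succ,
      show R + d + 1 - R = d + 1 by omega, show R + d + 1 - (R + 1) = d by omega,
      show R + d + 1 + (R + 1) = R + d + 1 + R + 1 by ring, qPoch_succ q q d,
      qPoch_succ q q (R + d + 1 + R)]
    have h1 := qPoch_ne_zero hq d
    have h2 := qPoch_ne_zero hq (R + d + 1 + R)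
    have h3 := hq d
    have h4 := hq (R + d + 1 + R)
    have h5 : 1 - q ^ (R + d + 1) ≠ 0 := by simpa [pow_succ'] using hq (R + d)
    field_simp
    ring

theorem sum_qPochCoeff_div_pow {q : ℂ} (hq0 : q ≠ 0) (hq : ∀ j : ℕ, 1 - q * q ^ j ≠ 0) (n : ℕ) :
    ∑ r ∈ Finset.range (n + 1 + 1), qPochCoeff q (n + 1) r / q ^ r = 0 := by
  rw [Finset.sum_range_succ, sum_qPochCoeff_div_pow_range hq0 hq n (n + 1) le_rfl, qPochCoeff,
    qPoch_succ q q (n + 1 + (n + 1)), Nat.sub_self, qPoch_zero]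
  have h2 := qPoch_ne_zero hq (n + 1 + (n + 1))
  have h4 := hq (n + 1 + (n + 1))
  have h5 : 1 - q ^ (n + 1) ≠ 0 := by simpa [pow_succ'] using hq n
  field_simp
  ring

theorem qPochCoeff_succ {q : ℂ} (hq : ∀ j : ℕ, 1 - q * q ^ j ≠ 0) {n r : ℕ} (hr : r ≤ n) :
    qPochCoeff q (n + 1) r * ((1 - q ^ (n + 1 - r)) * (1 - q ^ (n + r + 2))) =
      qPochCoeff q n r := by
  obtain ⟨d, rfl⟩ : ∃ d, n = r + d := ⟨n - r, by omega⟩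
  rw [qPochCoeff, qPochCoeff, show r + d + 1 - r = d + 1 by omega, show r + d - r = d by omega,
    show r + d + 1 + r + 1 = r + d + r + 1 + 1 by ring, qPoch_succ q q d,
    qPoch_succ q q (r + d + r + 1)]
  have h1 := qPoch_ne_zero hq d
  have h2 := qPoch_ne_zero hq (r + d + r + 1)
  have h3 := hq d
  have h4 := hq (r + d + r + 1)
  field_simp
  ring

theorem inv_qPoch_mul_qPoch {q A B : ℂ} (hq0 : q ≠ 0) (hq : ∀ j : ℕ, 1 - q * q ^ j ≠ 0)
    (hAB : A * B = q) (hA : ∀ j : ℕ, 1 - A * q ^ j ≠ 0) (hB : ∀ j : ℕ, 1 - B * q ^ j ≠ 0)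
    (n : ℕ) :
    (qPoch A q (n + 1) * qPoch B q (n + 1))⁻¹ =
      ∑ r ∈ Finset.range (n + 1), qPochCoeff q n r / ((1 - A * q ^ r) * (1 - B * q ^ r)) := by
  induction n with
  | zero =>
    have := hq 0
    have h3 := hA 0
    have h4 := hB 0
    simp [qPochCoeff, qPoch] at *
    field_simp
  | succ n ih =>
    have hstep : (1 - A * q ^ (n + 1)) * (1 - B * q ^ (n + 1)) *
        ∑ r ∈ Finset.range (n + 1 + 1),
          qPochCoeff q (n + 1) r / ((1 - A * q ^ r) * (1 - B * q ^ r)) =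
        ∑ r ∈ Finset.range (n + 1), qPochCoeff q n r / ((1 - A * q ^ r) * (1 - B * q ^ r)) := by
      have hterm : ∀ r ∈ Finset.range (n + 1 + 1),
          (1 - A * q ^ (n + 1)) * (1 - B * q ^ (n + 1)) *
            (qPochCoeff q (n + 1) r / ((1 - A * q ^ r) * (1 - B * q ^ r))) =
          qPochCoeff q (n + 1) r * ((1 - q ^ (n + 1 - r)) * (1 - q ^ (n + r + 2))) /
            ((1 - A * q ^ r) * (1 - B * q ^ r)) +
          q ^ (n + 1) * (qPochCoeff q (n + 1) r / q ^ r) := by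
        intro r hr
        obtain ⟨d, hd⟩ : ∃ d, n + 1 = r + d := ⟨n + 1 - r, by simp at hr; omega⟩
        rw [show n + r + 2 = r + d + r + 1 by omega, hd, show r + d - r = d by omega]
        have h1 := hA r
        have h2 := hB r
        generalize qPochCoeff q (r + d) r = c
        field_simp
        subst hAB
        ring
      rw [Finset.mul_sum, Finset.sum_congr rfl hterm, Finset.sum_add_distrib, ← Finset.mul_sum,
        sum_qPochCoeff_div_pow hq0 hq, Finset.sum_range_succ]
      simp only [Nat.sub_self, pow_zero, sub_self, zero_mul, mul_zero, zero_div, add_zero]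
      refine Finset.sum_congr rfl fun r hr => ?_
      rw [qPochCoeff_succ hq (by simp at hr; omega)]
    rw [qPoch_succ A, qPoch_succ B, mul_mul_mul_comm, mul_inv, ih, ← hstep, mul_comm,
      inv_mul_cancel_left₀ (mul_ne_zero (hA _) (hB _))]

theorem one_sub_mul_pow_ne_zero {a q : ℂ} (hq1 : ‖q‖ < 1) (ha : ‖a‖ < 1) (j : ℕ) :
    1 - a * q ^ j ≠ 0 := by
  intro h
  have h1 : ‖a * q ^ j‖ < 1 := by
    rw [norm_mul, norm_pow]
    exact mul_lt_one_of_nonneg_of_lt_one_left (norm_nonneg a) ha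
      (pow_le_one₀ (norm_nonneg q) hq1.le)
  rw [← sub_eq_zero.mp h, norm_one] at h1
  exact lt_irrefl _ h1

theorem summable_norm_mul_pow {q : ℂ} (hq1 : ‖q‖ < 1) (a : ℂ) :
    Summable fun j : ℕ => ‖-(a * q ^ j)‖ := by
  simpa using (summable_geometric_of_lt_one (norm_nonneg q) hq1).mul_left ‖a‖

theorem tendsto_qPoch {q : ℂ} (hq1 : ‖q‖ < 1) (a : ℂ) :
    Filter.Tendsto (qPoch a q) Filter.atTop (nhds (qPochInf a q)) := by
  have h := (multipliable_one_add_of_summable (summable_norm_mul_pow hq1 a)).tendsto_prod_tprod_nat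
  simp only [← sub_eq_add_neg] at h
  exact h

theorem qPochInf_ne_zero {a q : ℂ} (hq1 : ‖q‖ < 1) (h : ∀ j : ℕ, 1 - a * q ^ j ≠ 0) :
    qPochInf a q ≠ 0 := by
  have := tprod_one_add_ne_zero_of_summable (f := fun j : ℕ => -(a * q ^ j))
    (fun j => by simpa [← sub_eq_add_neg] using h j) (summable_norm_mul_pow hq1 a)
  simp only [← sub_eq_add_neg] at this
  exact this

theorem exists_norm_le_of_tendsto {f : ℕ → ℂ} {l : ℂ}
    (h : Filter.Tendsto f Filter.atTop (nhds l)) : ∃ C : ℝ, 0 ≤ C ∧ ∀ n, ‖f n‖ ≤ C := by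
  obtain ⟨C, hC⟩ := h.norm.bddAbove_range
  have hC' : ∀ n, ‖f n‖ ≤ C := fun n => hC ⟨n, rfl⟩
  exact ⟨C, (norm_nonneg _).trans (hC' 0), hC'⟩

theorem exists_norm_inv_one_sub_mul_pow_le {q : ℂ} (hq1 : ‖q‖ < 1) (a : ℂ) :
    ∃ C : ℝ, 0 ≤ C ∧ ∀ n : ℕ, ‖(1 - a * q ^ n)⁻¹‖ ≤ C := by
  have h : Filter.Tendsto (fun n : ℕ => 1 - a * q ^ n) Filter.atTop (nhds 1) := by
    simpa using ((tendsto_pow_atTop_nhds_zero_of_norm_lt_one hq1).const_mul a).const_sub 1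
  exact exists_norm_le_of_tendsto (h.inv₀ one_ne_zero)

theorem exists_norm_inv_qPoch_le {q : ℂ} (hq1 : ‖q‖ < 1) :
    ∃ C : ℝ, 0 ≤ C ∧ ∀ n : ℕ, ‖(qPoch q q n)⁻¹‖ ≤ C :=
  exists_norm_le_of_tendsto ((tendsto_qPoch hq1 q).inv₀
    (qPochInf_ne_zero hq1 (one_sub_mul_pow_ne_zero hq1 hq1)))

theorem norm_pow_triangle_le {q : ℂ} (hq1 : ‖q‖ < 1) (n : ℕ) :
    ‖q ^ (n * (n + 1) / 2)‖ ≤ ‖q‖ ^ n := by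
  rw [norm_pow]
  refine pow_le_pow_of_le_one (norm_nonneg q) hq1.le ?_
  rw [Nat.le_div_iff_mul_le two_pos]
  rcases n with _ | n
  · simp
  · exact Nat.mul_le_mul_left _ (by omega)

/-- The terms of the `₂φ₁` series, with one numerator parameter sent to infinity, that is
evaluated by the `q`-Gauss sum. -/
def qGaussTerm (q : ℂ) (r k m : ℕ) : ℂ :=
  qPoch (-q) q (r + m) * (q ^ (m * (m + 1) / 2) * (q ^ m) ^ k) *
    (qPoch q q m)⁻¹ * (qPoch q q (m + r + k + 1))⁻¹

theorem exists_norm_qGaussTerm_le {q : ℂ} (hq1 : ‖q‖ < 1) :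
    ∃ C : ℝ, ∀ r k m : ℕ, ‖qGaussTerm q r k m‖ ≤ C * ‖q‖ ^ m := by
  obtain ⟨A, hA0, hA⟩ := exists_norm_le_of_tendsto (tendsto_qPoch hq1 (-q))
  obtain ⟨B, hB0, hB⟩ := exists_norm_inv_qPoch_le hq1
  refine ⟨A * B * B, fun r k m => ?_⟩
  have h : ‖q ^ (m * (m + 1) / 2) * (q ^ m) ^ k‖ ≤ ‖q‖ ^ m := by
    rw [norm_mul, norm_pow (q ^ m), norm_pow q m]
    exact (mul_le_of_le_one_right (norm_nonneg _)
      (pow_le_one₀ (by positivity) (pow_le_one₀ (norm_nonneg q) hq1.le))).trans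
      (norm_pow_triangle_le hq1 m)
  rw [qGaussTerm, norm_mul, norm_mul, norm_mul]
  calc _ ≤ A * ‖q‖ ^ m * B * B := by
        gcongr
        exacts [hA _, hB _, hB _]
    _ = _ := by ring

theorem summable_qGaussTerm {q : ℂ} (hq1 : ‖q‖ < 1) (r k : ℕ) : Summable (qGaussTerm q r k) := by
  obtain ⟨C, hC⟩ := exists_norm_qGaussTerm_le hq1
  exact .of_norm_bounded ((summable_geometric_of_lt_one (norm_nonneg q) hq1).mul_left C) (hC r k)

theorem tsum_qGaussTerm_succ {q : ℂ} (hq1 : ‖q‖ < 1) (r k : ℕ) :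
    ∑' m, qGaussTerm q r k m = (1 + q ^ (k + 1)) * ∑' m, qGaussTerm q r (k + 1) m := by
  have hq := one_sub_mul_pow_ne_zero hq1 hq1
  let G : ℕ → ℂ := fun m => -(qGaussTerm q r k m * (1 - q ^ m))
  have hG : Summable G := by
    obtain ⟨C, hC⟩ := exists_norm_qGaussTerm_le hq1
    refine .of_norm_bounded
      (((summable_geometric_of_lt_one (norm_nonneg q) hq1).mul_left C).mul_right 2) fun m => ?_
    rw [norm_neg, norm_mul]
    refine mul_le_mul (hC r k m) ?_ (norm_nonneg _) ((norm_nonneg _).trans (hC r k m))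
    refine (norm_sub_le _ _).trans ?_
    rw [norm_one, norm_pow]
    linarith [pow_le_one₀ (n := m) (norm_nonneg q) hq1.le]
  have hterm : ∀ m, qGaussTerm q r k m - (1 + q ^ (k + 1)) * qGaussTerm q r (k + 1) m =
      G (m + 1) - G m := by
    intro m
    simp only [G, qGaussTerm]
    rw [show m + 1 + r + k + 1 = m + r + k + 1 + 1 by ring,
      show m + r + (k + 1) + 1 = m + r + k + 1 + 1 by ring, ← add_assoc r m 1,
      pow_triangle_succ, qPoch_succ q q (m + r + k + 1), qPoch_succ q q m,
      qPoch_succ (-q) q (r + m)]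
    have h1 := qPoch_ne_zero hq m
    have h2 := qPoch_ne_zero hq (m + r + k + 1)
    have h3 := hq m
    have h4 := hq (m + r + k + 1)
    field_simp
    ring
  have hG0 : G 0 = 0 := by simp [G]
  rw [← sub_eq_zero, ← tsum_mul_left, ← (summable_qGaussTerm hq1 r k).tsum_sub
    ((summable_qGaussTerm hq1 r (k + 1)).mul_left _), tsum_congr hterm,
    ((summable_nat_add_iff 1).mpr hG).tsum_sub hG, hG.tsum_eq_zero_add, hG0, zero_add, sub_self]

theorem tendsto_tsum_qGaussTerm {q : ℂ} (hq1 : ‖q‖ < 1) (r : ℕ) :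
    Filter.Tendsto (fun k => ∑' m, qGaussTerm q r k m) Filter.atTop
      (nhds (qPoch (-q) q r * (qPochInf q q)⁻¹)) := by
  obtain ⟨C, hC⟩ := exists_norm_qGaussTerm_le hq1
  have hinf := qPochInf_ne_zero hq1 (one_sub_mul_pow_ne_zero hq1 hq1)
  have hQ : ∀ m, Filter.Tendsto (fun k => (qPoch q q (m + r + k + 1))⁻¹) Filter.atTop
      (nhds (qPochInf q q)⁻¹) := fun m =>
    ((tendsto_qPoch hq1 q).comp (Filter.tendsto_atTop_mono
      (fun k => show k ≤ m + r + k + 1 by omega) Filter.tendsto_id)).inv₀ hinf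
  have h := tendsto_tsum_of_dominated_convergence (𝓕 := Filter.atTop) (f := qGaussTerm q r)
    (g := fun m => if m = 0 then qPoch (-q) q r * (qPochInf q q)⁻¹ else 0)
    ((summable_geometric_of_lt_one (norm_nonneg q) hq1).mul_left C) (fun m => ?_)
    (Filter.Eventually.of_forall fun k m => hC r k m)
  · simpa using h
  · rcases eq_or_ne m 0 with rfl | hm
    · simpa [qGaussTerm] using (hQ 0).const_mul (qPoch (-q) q r)
    · have hp : Filter.Tendsto (fun k => (q ^ m) ^ k) Filter.atTop (nhds 0) :=
        tendsto_pow_atTop_nhds_zero_of_norm_lt_one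
          (by rw [norm_pow]; exact pow_lt_one₀ (norm_nonneg q) hq1 hm)
      simpa [qGaussTerm, hm] using
        (((hp.const_mul (q ^ (m * (m + 1) / 2))).const_mul (qPoch (-q) q (r + m))).mul_const
          (qPoch q q m)⁻¹).mul (hQ m)

theorem tsum_qGaussTerm_self {q : ℂ} (hq1 : ‖q‖ < 1) (r : ℕ) :
    ∑' m, qGaussTerm q r r m = qPochInf (-q) q * (qPochInf q q)⁻¹ := by
  have hconst : ∀ k, qPoch (-q) q k * ∑' m, qGaussTerm q r k m = ∑' m, qGaussTerm q r 0 m := by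
    intro k
    induction k with
    | zero => simp
    | succ k ih => rw [← ih, tsum_qGaussTerm_succ hq1 r k, qPoch_succ]; ring
  have hlim := (tendsto_qPoch hq1 (-q)).mul (tendsto_tsum_qGaussTerm hq1 r)
  simp only [hconst] at hlim
  have h := (hconst r).trans (tendsto_nhds_unique tendsto_const_nhds hlim)
  refine mul_left_cancel₀ (qPoch_ne_zero
    (one_sub_mul_pow_ne_zero hq1 (by rwa [norm_neg])) r) (h.trans ?_)
  ring

theorem tsum_sum_antidiagonal {F : ℕ × ℕ → ℂ} (hF : Summable F) :
    ∑' n, ∑ kl ∈ Finset.HasAntidiagonal.antidiagonal n, F kl = ∑' r, ∑' m, F (r, m) := by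
  have hs : Summable fun x : (Σ n : ℕ, Finset.HasAntidiagonal.antidiagonal n) => F x.2 :=
    Finset.HasAntidiagonal.sigmaAntidiagonalEquivProd.summable_iff.mpr hF
  rw [← hF.tsum_prod' fun r => hF.comp_injective (Prod.mk_right_injective r),
    ← Finset.HasAntidiagonal.sigmaAntidiagonalEquivProd.tsum_eq F]
  refine Eq.trans (tsum_congr fun n => ?_) (hs.tsum_sigma' fun n => (hasSum_fintype _).summable).symm
  rw [tsum_fintype]
  exact (Finset.sum_finset_coe F _).symm

/-- The `r`-th term of the generalized Lambert series after pairing the indices `r` and `-r-1`. -/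
def lambertTerm (A B q : ℂ) (r : ℕ) : ℂ :=
  (-1) ^ r * q ^ (r * (r + 1)) * (1 - q ^ (2 * r + 1)) / ((1 - A * q ^ r) * (1 - B * q ^ r))

theorem summable_neg_one_pow_mul {q : ℂ} (hq1 : ‖q‖ < 1) {x : ℕ → ℂ} {C : ℝ}
    (hx : ∀ r, ‖x r‖ ≤ C) : Summable fun r : ℕ => ‖(-1) ^ r * q ^ (r * (r + 1)) * x r‖ := by
  refine .of_nonneg_of_le (fun _ => norm_nonneg _) (fun r => ?_)
    ((summable_geometric_of_lt_one (norm_nonneg q) hq1).mul_right C)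
  rw [norm_mul, norm_mul, norm_pow (-1 : ℂ), norm_neg, norm_one, one_pow, one_mul, norm_pow]
  exact mul_le_mul (pow_le_pow_of_le_one (norm_nonneg q) hq1.le
    (Nat.le_mul_of_pos_right r r.succ_pos)) (hx r) (norm_nonneg _) (by positivity)

theorem norm_mul_pow_le {q : ℂ} (hq1 : ‖q‖ < 1) (a : ℂ) (r : ℕ) : ‖a * q ^ r‖ ≤ ‖a‖ := by
  rw [norm_mul, norm_pow]
  exact mul_le_of_le_one_right (norm_nonneg _) (pow_le_one₀ (norm_nonneg q) hq1.le)

theorem lambertTerm_eq_add {q A B : ℂ} (hAB : A * B = q) {r : ℕ} (hA : 1 - A * q ^ r ≠ 0)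
    (hB : 1 - B * q ^ r ≠ 0) :
    lambertTerm A B q r = (-1) ^ r * q ^ (r * (r + 1)) * (1 - A * q ^ r)⁻¹ +
      (-1) ^ r * q ^ (r * (r + 1)) * (B * q ^ r * (1 - B * q ^ r)⁻¹) := by
  rw [lambertTerm, pow_succ, pow_mul' q 2 r]
  have h : A * B * (q ^ r) ^ 2 = (q ^ r) ^ 2 * q := by rw [hAB, mul_comm]
  rw [← h]
  field_simp
  ring

theorem summable_lambert_fst {q : ℂ} (hq1 : ‖q‖ < 1) (a : ℂ) :
    Summable fun r : ℕ => ‖(-1) ^ r * q ^ (r * (r + 1)) * (1 - a * q ^ r)⁻¹‖ := by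
  obtain ⟨C, -, hC⟩ := exists_norm_inv_one_sub_mul_pow_le hq1 a
  exact summable_neg_one_pow_mul hq1 hC

theorem summable_lambert_snd {q : ℂ} (hq1 : ‖q‖ < 1) (a : ℂ) :
    Summable fun r : ℕ => ‖(-1) ^ r * q ^ (r * (r + 1)) * (a * q ^ r * (1 - a * q ^ r)⁻¹)‖ := by
  obtain ⟨C, -, hC⟩ := exists_norm_inv_one_sub_mul_pow_le hq1 a
  refine summable_neg_one_pow_mul hq1 (C := ‖a‖ * C) fun r => ?_
  rw [norm_mul]
  exact mul_le_mul (norm_mul_pow_le hq1 a r) (hC r) (norm_nonneg _) (norm_nonneg _)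

theorem summable_lambertTerm {q A B : ℂ} (hq1 : ‖q‖ < 1) (hAB : A * B = q)
    (hA : ∀ j : ℕ, 1 - A * q ^ j ≠ 0) (hB : ∀ j : ℕ, 1 - B * q ^ j ≠ 0) :
    Summable fun r => ‖lambertTerm A B q r‖ := by
  simp only [fun r => lambertTerm_eq_add hAB (hA r) (hB r)]
  exact .of_nonneg_of_le (fun _ => norm_nonneg _) (fun r => norm_add_le _ _)
    ((summable_lambert_fst hq1 A).add (summable_lambert_snd hq1 B))

theorem pow_triangle_add (q : ℂ) (r m : ℕ) :
    q ^ ((r + m) * (r + m + 1) / 2) =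
      q ^ (r * (r + 1) / 2) * (q ^ (m * (m + 1) / 2) * (q ^ m) ^ r) := by
  induction m with
  | zero => simp
  | succ m ih => rw [← add_assoc, pow_triangle_succ, pow_triangle_succ, ih]; ring

theorem pow_triangle_mul_self (q : ℂ) (r : ℕ) :
    q ^ (r * (r + 1) / 2) * q ^ (r * (r + 1) / 2) = q ^ (r * (r + 1)) := by
  rw [← pow_add, ← two_mul, Nat.mul_div_cancel' (Nat.even_mul_succ_self r).two_dvd]

theorem lambertTerm_mul_qGaussTerm (q A B : ℂ) (r m : ℕ) :
    lambertTerm A B q r * qGaussTerm q r r m =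
      qPoch (-q) q (r + m) * q ^ ((r + m) * (r + m + 1) / 2) *
        (qPochCoeff q (r + m) r / ((1 - A * q ^ r) * (1 - B * q ^ r))) := by
  rw [lambertTerm, qGaussTerm, qPochCoeff, pow_triangle_add, ← pow_triangle_mul_self,
    Nat.add_sub_cancel_left, show r + m + r + 1 = m + r + r + 1 by ring, div_eq_mul_inv,
    div_eq_mul_inv, div_eq_mul_inv, mul_inv (qPoch q q m)]
  ring

theorem tsum_qPoch_div_eq {q A B : ℂ} (hq0 : q ≠ 0) (hq1 : ‖q‖ < 1) (hAB : A * B = q)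
    (hA : ∀ j : ℕ, 1 - A * q ^ j ≠ 0) (hB : ∀ j : ℕ, 1 - B * q ^ j ≠ 0) :
    ∑' n : ℕ, qPoch (-q) q n * q ^ (n * (n + 1) / 2) /
        (qPoch A q (n + 1) * qPoch B q (n + 1)) =
      qPochInf (-q) q / qPochInf q q * ∑' r, lambertTerm A B q r := by
  have hF : Summable fun x : ℕ × ℕ => lambertTerm A B q x.1 * qGaussTerm q x.1 x.1 x.2 := by
    obtain ⟨C, hC⟩ := exists_norm_qGaussTerm_le hq1
    refine .of_norm_bounded ((summable_lambertTerm hq1 hAB hA hB).mul_of_nonneg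
      ((summable_geometric_of_lt_one (norm_nonneg q) hq1).mul_left C) (fun _ => norm_nonneg _)
      fun m => (norm_nonneg _).trans (hC 0 0 m)) fun x => ?_
    rw [norm_mul]
    exact mul_le_mul_of_nonneg_left (hC _ _ _) (norm_nonneg _)
  have h := tsum_sum_antidiagonal hF
  simp only [tsum_mul_left, tsum_qGaussTerm_self hq1] at h
  rw [tsum_mul_right, mul_comm, ← div_eq_mul_inv] at h
  rw [← h]
  refine tsum_congr fun n => ?_
  rw [div_eq_mul_inv, inv_qPoch_mul_qPoch hq0 (one_sub_mul_pow_ne_zero hq1 hq1) hAB hA hB,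
    Finset.Nat.sum_antidiagonal_eq_sum_range_succ
      (fun r m => lambertTerm A B q r * qGaussTerm q r r m), Finset.mul_sum]
  refine Finset.sum_congr rfl fun r hr => ?_
  rw [lambertTerm_mul_qGaussTerm, Nat.add_sub_cancel' (by simp at hr; omega)]

theorem tsum_lambertTerm_eq {q A B : ℂ} (hq0 : q ≠ 0) (hq1 : ‖q‖ < 1) (hAB : A * B = q)
    (hA : ∀ j : ℕ, 1 - A * q ^ j ≠ 0) (hB : ∀ j : ℕ, 1 - B * q ^ j ≠ 0) :
    ∑' r, lambertTerm A B q r =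
      ∑' n : ℤ, (-1 : ℂ) ^ n * q ^ (n * (n + 1)) / (1 - A * q ^ n) := by
  have h1 : ∀ r : ℕ, (-1 : ℂ) ^ (r : ℤ) * q ^ ((r : ℤ) * (r + 1)) / (1 - A * q ^ (r : ℤ)) =
      (-1) ^ r * q ^ (r * (r + 1)) * (1 - A * q ^ r)⁻¹ := fun r => by
    rw [div_eq_mul_inv]
    norm_cast
  have h2 : ∀ r : ℕ, (-1 : ℂ) ^ (-((r : ℤ) + 1)) *
      q ^ (-((r : ℤ) + 1) * (-((r : ℤ) + 1) + 1)) / (1 - A * q ^ (-((r : ℤ) + 1))) =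
      (-1) ^ r * q ^ (r * (r + 1)) * (B * q ^ r * (1 - B * q ^ r)⁻¹) := fun r => by
    have hA0 : A ≠ 0 := left_ne_zero_of_mul (hAB ▸ hq0)
    have hx : q * q ^ r - A ≠ 0 := fun h => hB r <| by
      apply mul_left_cancel₀ hA0
      rw [mul_sub, ← mul_assoc, hAB]
      linear_combination -h
    have hB' : 1 - q ^ r * B ≠ 0 := mul_comm B (q ^ r) ▸ hB r
    rw [show -((r : ℤ) + 1) * (-((r : ℤ) + 1) + 1) = ((r * (r + 1) : ℕ) : ℤ) by push_cast; ring,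
      zpow_neg, zpow_neg, ← Nat.cast_succ, zpow_natCast, zpow_natCast, zpow_natCast,
      ← inv_pow, inv_neg_one, Nat.succ_eq_add_one, pow_succ (-1 : ℂ), mul_assoc, mul_assoc,
      mul_div_assoc]
    congr 1
    rw [pow_succ' q, show 1 - A * (q * q ^ r)⁻¹ = (q * q ^ r - A) / (q * q ^ r) by field_simp]
    field_simp
    linear_combination hAB
  rw [tsum_of_nat_of_neg_add_one]
  · simp only [h1, h2, fun r => lambertTerm_eq_add hAB (hA r) (hB r)]
    exact (summable_lambert_fst hq1 A).of_norm.tsum_add (summable_lambert_snd hq1 B).of_norm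
  · simpa only [h1] using (summable_lambert_fst hq1 A).of_norm
  · simpa only [h2] using (summable_lambert_snd hq1 B).of_norm

/-- the generalized Lambert series expansion of `g₂`. -/
theorem g2_lambert (τ : ℂ) (hτ : 0 < τ.im) (q : ℂ)
    (hq : q = Complex.exp (2 * Real.pi * Complex.I * τ))
    (w : ℂ) (hw0 : w ≠ 0) (hw : ∀ n : ℤ, w ≠ q ^ n) :
    g2 w q = qPochInf (-q) q / qPochInf q q *
      ∑' n : ℤ, (-1 : ℂ) ^ n * q ^ (n * (n + 1)) / (1 - w * q ^ n) := by
  have hq0 : q ≠ 0 := hq ▸ Complex.exp_ne_zero _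
  have hq1 : ‖q‖ < 1 := by
    rw [hq]
    exact UpperHalfPlane.norm_exp_two_pi_I_lt_one ⟨τ, hτ⟩
  have hwq : w * (q / w) = q := mul_div_cancel₀ q hw0
  have hA : ∀ j : ℕ, 1 - w * q ^ j ≠ 0 := fun j h => hw (-j) <| by
    rw [zpow_neg, zpow_natCast]
    exact eq_inv_of_mul_eq_one_left (sub_eq_zero.mp h).symm
  have hB : ∀ j : ℕ, 1 - q / w * q ^ j ≠ 0 := fun j h => hw (j + 1 : ℕ) <| by
    rw [zpow_natCast]
    field_simp at h
    rw [pow_succ']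
    linear_combination h
  rw [g2, tsum_qPoch_div_eq hq0 hq1 hwq hA hB, tsum_lambertTerm_eq hq0 hq1 hwq hA hB]

end
end

section
/- For every natural number n, N₍₆₎(n) = Σ_{k ≥ 0, 3k ≤ n} M₍₂₎(k)·p_3(n−3k), where N₍₆₎(n) := N(0,6,n) + N(1,6,n) + N(5,6,n) − N(2,6,n) − N(3,6,n) − N(4,6,n) and M₍₂₎(n) := M(0,2,n) − M(1,2,n). -/
open Finset

noncomputable section

/-- The rank of a partition: largest part minus the number of parts. -/
def Nat.Partition.rank {n : ℕ} (p : n.Partition) : ℤ :=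
  (p.parts.sup : ℤ) - p.parts.card

/-- `N m n`: the number of partitions of `n` with rank `m`. -/
def rankCount (m : ℤ) (n : ℕ) : ℕ :=
  (Finset.univ.filter fun p : n.Partition => p.rank = m).card

/-- The crank of a partition. -/
def Nat.Partition.crank {n : ℕ} (p : n.Partition) : ℤ :=
  if p.parts.count 1 = 0 then (p.parts.sup : ℤ)
  else ((p.parts.filter fun x => p.parts.count 1 < x).card : ℤ) - p.parts.count 1

/-- `M m n`: the number of partitions of `n` with crank `m`, with the special
convention at `n = 1`. -/
def crankCount (m : ℤ) (n : ℕ) : ℤ :=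
  if n = 1 then (if m = 0 then -1 else if m = 1 ∨ m = -1 then 1 else 0)
  else ((Finset.univ.filter fun p : n.Partition => p.crank = m).card : ℤ)

/-- `p₃ n`: the number of partitions of `n` into parts congruent to `±1` mod `3`. -/
def p3 (n : ℕ) : ℕ :=
  (Finset.univ.filter fun p : n.Partition =>
    ∀ x ∈ p.parts, x % 3 = 1 ∨ x % 3 = 2).card

/-- `N(t,6,n)`: the number of partitions of `n` with rank congruent to `t` mod `6`. -/
def rankCountMod6 (t : ℤ) (n : ℕ) : ℕ :=
  (Finset.univ.filter fun p : n.Partition => p.rank % 6 = t % 6).card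

/-- `M(t,2,n) = Σ_{m ≡ t (mod 2)} M(m,n)` (a finite sum, since the crank of a
partition of `n` lies in `[-n, n]`). -/
def crankCountMod2 (t : ℤ) (n : ℕ) : ℤ :=
  ∑ m ∈ Finset.Icc (-(n : ℤ)) (n : ℤ), if m % 2 = t % 2 then crankCount m n else 0

def N6 (n : ℕ) : ℤ :=
  (rankCountMod6 0 n + rankCountMod6 1 n + rankCountMod6 5 n : ℤ)
    - rankCountMod6 2 n - rankCountMod6 3 n - rankCountMod6 4 n

def M2 (n : ℕ) : ℤ := crankCountMod2 0 n - crankCountMod2 1 n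

/-- The number of partitions of the integer `n` (as multisets of positive integers) satisfying
`P`. -/
def partCount (P : Multiset ℕ → Prop) (n : ℤ) : ℤ :=
  ({s : Multiset ℕ | 0 ∉ s ∧ (s.sum : ℤ) = n ∧ P s}.ncard : ℤ)

/-- The rank of a multiset of parts. -/
def msRank (s : Multiset ℕ) : ℤ := (s.sup : ℤ) - s.card

/-- The crank of a multiset of parts. -/
def msCrank (s : Multiset ℕ) : ℤ :=
  if s.count 1 = 0 then (s.sup : ℤ)
  else ((s.filter fun x => s.count 1 < x).card : ℤ) - s.count 1

lemma partCount_nat_set (P : Multiset ℕ → Prop) (n : ℕ) :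
    {s : Multiset ℕ | 0 ∉ s ∧ (s.sum : ℤ) = n ∧ P s}
      = (fun p : n.Partition => p.parts) '' {p | P p.parts} := by
  ext s
  constructor
  · rintro ⟨h0, hs, hP⟩
    exact ⟨⟨s, fun {i} hi => Nat.pos_of_ne_zero fun h => h0 (h ▸ hi), by exact_mod_cast hs⟩,
      hP, rfl⟩
  · rintro ⟨p, hp, rfl⟩
    exact ⟨fun h => (p.parts_pos h).ne rfl, by exact_mod_cast p.parts_sum, hp⟩

lemma partCount_natCast (P : Multiset ℕ → Prop) [DecidablePred P] (n : ℕ) :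
    partCount P n = ∑ p : n.Partition, if P p.parts then 1 else 0 := by
  rw [partCount, partCount_nat_set, Set.ncard_image_of_injective _ fun p q h =>
    Nat.Partition.ext h, Finset.sum_boole, Set.ncard_eq_toFinset_card']
  congr 2
  ext p
  simp

lemma partCount_of_neg (P : Multiset ℕ → Prop) {n : ℤ} (hn : n < 0) : partCount P n = 0 := by
  have : {s : Multiset ℕ | 0 ∉ s ∧ (s.sum : ℤ) = n ∧ P s} = ∅ := by
    ext s
    simp only [Set.mem_ofPred_eq, Set.mem_empty_iff_false, iff_false]
    rintro ⟨-, h, -⟩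
    omega
  rw [partCount, this]
  simp

lemma finite_parts (P : Multiset ℕ → Prop) (n : ℤ) :
    {s : Multiset ℕ | 0 ∉ s ∧ (s.sum : ℤ) = n ∧ P s}.Finite := by
  rcases lt_or_ge n 0 with hn | hn
  · refine Set.finite_empty.subset ?_
    rintro s ⟨-, h, -⟩
    omega
  · lift n to ℕ using hn
    rw [partCount_nat_set]
    exact Set.toFinite _

lemma partCount_congr {P Q : Multiset ℕ → Prop} {n : ℤ}
    (h : ∀ s : Multiset ℕ, 0 ∉ s → (s.sum : ℤ) = n → (P s ↔ Q s)) :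
    partCount P n = partCount Q n := by
  unfold partCount
  congr 2
  ext s
  exact ⟨fun ⟨a, b, c⟩ => ⟨a, b, (h s a b).1 c⟩, fun ⟨a, b, c⟩ => ⟨a, b, (h s a b).2 c⟩⟩

lemma partCount_eq_zero {P : Multiset ℕ → Prop} {n : ℤ}
    (h : ∀ s : Multiset ℕ, 0 ∉ s → (s.sum : ℤ) = n → ¬ P s) : partCount P n = 0 := by
  rw [partCount_congr (Q := fun _ => False) fun s a b => by simp [h s a b]]
  simp [partCount]

lemma partCount_split (P Q : Multiset ℕ → Prop) (n : ℤ) :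
    partCount P n = partCount (fun s => P s ∧ Q s) n + partCount (fun s => P s ∧ ¬ Q s) n := by
  unfold partCount
  rw [← Nat.cast_add, ← Set.ncard_union_eq _ (finite_parts _ n) (finite_parts _ n)]
  · congr 2
    ext s
    simp only [Set.mem_ofPred_eq, Set.mem_union]
    tauto
  · rw [Set.disjoint_left]
    rintro s ⟨-, -, -, h⟩ ⟨-, -, -, h'⟩
    exact h' h

lemma partCount_bij {P Q : Multiset ℕ → Prop} {n m : ℤ} (f g : Multiset ℕ → Multiset ℕ)
    (hf : ∀ s : Multiset ℕ, 0 ∉ s → (s.sum : ℤ) = n → P s →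
      0 ∉ f s ∧ ((f s).sum : ℤ) = m ∧ Q (f s) ∧ g (f s) = s)
    (hg : ∀ s : Multiset ℕ, 0 ∉ s → (s.sum : ℤ) = m → Q s →
      0 ∉ g s ∧ ((g s).sum : ℤ) = n ∧ P (g s) ∧ f (g s) = s) :
    partCount P n = partCount Q m := by
  unfold partCount
  congr 1
  refine Set.ncard_congr (fun s _ => f s) ?_ ?_ ?_
  · rintro s ⟨a, b, c⟩
    obtain ⟨h1, h2, h3, -⟩ := hf s a b c
    exact ⟨h1, h2, h3⟩
  · rintro s s' ⟨a, b, c⟩ ⟨a', b', c'⟩ h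
    rw [← (hf s a b c).2.2.2, ← (hf s' a' b' c').2.2.2]
    exact congrArg g h
  · rintro s ⟨a, b, c⟩
    obtain ⟨h1, h2, h3, h4⟩ := hg s a b c
    exact ⟨g s, ⟨h1, h2, h3⟩, h4⟩

lemma card_le_sum {s : Multiset ℕ} (h : 0 ∉ s) : s.card ≤ s.sum := by
  have := Multiset.card_nsmul_le_sum (s := s) (a := 1)
    fun x hx => Nat.pos_of_ne_zero fun h' => h (h' ▸ hx)
  simpa using this

lemma sup_le_sum (s : Multiset ℕ) : s.sup ≤ s.sum :=
  Multiset.sup_le.2 fun _ hx => Multiset.le_sum_of_mem hx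

lemma sup_mem {s : Multiset ℕ} (h : s ≠ 0) : s.sup ∈ s := by
  induction s using Multiset.induction_on with
  | empty => exact absurd rfl h
  | cons a s ih =>
    rw [Multiset.sup_cons]
    rcases eq_or_ne s 0 with rfl | hs
    · simp
    · rcases le_total a s.sup with h' | h'
      · rw [sup_eq_right.2 h']
        exact Multiset.mem_cons_of_mem (ih hs)
      · rw [sup_eq_left.2 h']
        exact Multiset.mem_cons_self _ _

lemma sum_map_pred_add_card {s : Multiset ℕ} (h : 0 ∉ s) :
    (s.map Nat.pred).sum + s.card = s.sum := by
  induction s using Multiset.induction_on with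
  | empty => simp
  | cons a s ih =>
    simp only [Multiset.mem_cons, not_or] at h
    have := ih h.2
    have h1 : a ≠ 0 := fun h' => h.1 h'.symm
    simp only [Multiset.map_cons, Multiset.sum_cons, Multiset.card_cons, Nat.pred_eq_sub_one]
      at this ⊢
    omega

lemma sum_map_succ (s : Multiset ℕ) : (s.map Nat.succ).sum = s.sum + s.card := by
  induction s using Multiset.induction_on with
  | empty => simp
  | cons a s ih => simp [ih]; omega

lemma multiset_sum_filter_ne_zero (s : Multiset ℕ) : (s.filter (· ≠ 0)).sum = s.sum := by
  induction s using Multiset.induction_on with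
  | empty => simp
  | cons a s ih =>
    by_cases h : a = 0
    · simpa [h] using ih
    · simpa [h] using ih

lemma map_succ_filter_map_pred {s : Multiset ℕ} (h : 0 ∉ s) :
    ((s.map Nat.pred).filter (· ≠ 0)).map Nat.succ
      + Multiset.replicate (s.card - ((s.map Nat.pred).filter (· ≠ 0)).card) 1 = s := by
  induction s using Multiset.induction_on with
  | empty => simp
  | cons a s ih =>
    simp only [Multiset.mem_cons, not_or] at h
    have ih := ih h.2
    have hle : ((s.map Nat.pred).filter (· ≠ 0)).card ≤ s.card := by
      simpa using Multiset.card_le_card (Multiset.filter_le (· ≠ 0) (s.map Nat.pred))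
    obtain ⟨a, rfl⟩ := Nat.exists_eq_succ_of_ne_zero (Ne.symm h.1)
    rcases Nat.eq_zero_or_pos a with rfl | ha
    · rw [Multiset.map_cons, Multiset.filter_cons_of_neg _ (by simp), Multiset.card_cons,
        Nat.succ_sub hle, Multiset.replicate_succ, Multiset.add_cons, ih]
    · rw [Multiset.map_cons, Multiset.filter_cons_of_pos _ (by simpa using ha.ne'),
        Multiset.card_cons, Multiset.card_cons, Nat.succ_sub_succ, Multiset.map_cons,
        Multiset.cons_add, ih]
      rfl

/-- Dyson's map: remove the first column (of height `ℓ`) and insert a row of size `ℓ + r`. -/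
def dysonMap (r : ℤ) (s : Multiset ℕ) : Multiset ℕ :=
  (((s.card : ℤ) + r).toNat ::ₘ s.map Nat.pred).filter (· ≠ 0)

/-- The inverse of Dyson's map. -/
def dysonInv (r : ℤ) (s : Multiset ℕ) : Multiset ℕ :=
  (s.erase s.sup).map Nat.succ
    + Multiset.replicate (((s.sup : ℤ) - r).toNat - (s.erase s.sup).card) 1

lemma partCount_dyson {r : ℤ} (h1 : r ≠ 1) (h2 : r ≠ -1) (n : ℤ) :
    partCount (fun s => msRank s ≤ r + 1) n = partCount (fun s => r - 1 ≤ msRank s) (n + r) := by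
  refine partCount_bij (dysonMap r) (dysonInv r) ?_ ?_
  · intro s h0 hs hP
    unfold msRank at hP
    have hc : 0 ≤ (s.card : ℤ) + r := by
      rcases eq_or_ne s 0 with rfl | hne
      · simp at hP ⊢; omega
      · have : s.sup ≠ 0 := fun h => h0 (h ▸ sup_mem hne)
        omega
    obtain ⟨c, hc'⟩ := Int.eq_ofNat_of_zero_le hc
    have hle : ∀ x ∈ s.map Nat.pred, x ≤ c := by
      intro x hx
      obtain ⟨y, hy, rfl⟩ := Multiset.mem_map.1 hx
      have := Multiset.le_sup hy
      simp only [Nat.pred_eq_sub_one]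
      omega
    have hf : dysonMap r s = (c ::ₘ s.map Nat.pred).filter (· ≠ 0) := by
      rw [dysonMap, hc', Int.toNat_natCast]
    have hcard : ((s.map Nat.pred).filter (· ≠ 0)).card ≤ s.card := by
      simpa using Multiset.card_le_card (Multiset.filter_le (· ≠ 0) (s.map Nat.pred))
    have hsup : (dysonMap r s).sup = c ∧
        (dysonMap r s).erase c = (s.map Nat.pred).filter (· ≠ 0) ∧
        r - 1 ≤ msRank (dysonMap r s) := by
      rw [hf]
      have hle' : ((s.map Nat.pred).filter (· ≠ 0)).sup ≤ c :=
        Multiset.sup_le.2 fun x hx => hle x (Multiset.mem_of_mem_filter hx)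
      rcases Nat.eq_zero_or_pos c with h | h
      · have : (s.map Nat.pred).filter (· ≠ 0) = 0 := by
          rw [Multiset.filter_eq_nil]
          intro x hx
          have := hle x hx
          omega
        rw [Multiset.filter_cons_of_neg _ (by simpa using h), this]
        simp [msRank, h]
        omega
      · rw [Multiset.filter_cons_of_pos (p := (· ≠ 0)) _ h.ne', Multiset.sup_cons,
          sup_eq_left.2 hle']
        refine ⟨rfl, by simp, ?_⟩
        rw [msRank, Multiset.sup_cons, sup_eq_left.2 hle', Multiset.card_cons]
        push_cast
        omega
    refine ⟨by simp [dysonMap], ?_, hsup.2.2, ?_⟩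
    · have := sum_map_pred_add_card h0
      rw [hf, multiset_sum_filter_ne_zero, Multiset.sum_cons]
      push_cast [← hs, ← this]
      rw [← hc']
      ring
    · rw [dysonInv, hsup.1, hsup.2.1, show ((c : ℤ) - r).toNat = s.card by omega]
      exact map_succ_filter_map_pred h0
  · intro s h0 hs hP
    unfold msRank at hP
    have hkey : ((s.erase s.sup).card : ℤ) ≤ s.sup - r ∧
        s.sup + (s.erase s.sup).sum = s.sum ∧
        (s.sup ::ₘ s.erase s.sup).filter (· ≠ 0) = s := by
      rcases eq_or_ne s 0 with rfl | hne
      · simp at hP ⊢; omega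
      · have hm := sup_mem hne
        have h3 := Multiset.card_erase_add_one hm
        refine ⟨by omega, ?_, ?_⟩
        · rw [← Multiset.sum_cons, Multiset.cons_erase hm]
        · rw [Multiset.cons_erase hm, Multiset.filter_eq_self]
          exact fun x hx h => h0 (h ▸ hx)
    obtain ⟨hk1, hk2, hk3⟩ := hkey
    have hcard : ((dysonInv r s).card : ℤ) = s.sup - r := by
      simp only [dysonInv, Multiset.card_add, Multiset.card_map, Multiset.card_replicate]
      omega
    refine ⟨?_, ?_, ?_, ?_⟩
    · simp [dysonInv, Multiset.mem_replicate]
    · rw [dysonInv, Multiset.sum_add, sum_map_succ, Multiset.sum_replicate, smul_eq_mul, mul_one]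
      omega
    · rw [msRank, hcard]
      have : (dysonInv r s).sup ≤ s.sup + 1 := by
        refine Multiset.sup_le.2 fun x hx => ?_
        rw [dysonInv, Multiset.mem_add] at hx
        rcases hx with hx | hx
        · obtain ⟨y, hy, rfl⟩ := Multiset.mem_map.1 hx
          exact Nat.succ_le_succ (Multiset.le_sup (Multiset.mem_of_mem_erase hy))
        · have := Multiset.eq_of_mem_replicate hx
          omega
      omega
    · rw [dysonMap, hcard, show ((s.sup : ℤ) - r + r).toNat = s.sup by omega, dysonInv,
        Multiset.map_add, Multiset.map_map]
      simp only [Function.comp_def, Nat.pred_succ, Multiset.map_id', Multiset.map_replicate]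
      rw [← Multiset.cons_add, Multiset.filter_add, hk3]
      simp [Multiset.mem_replicate]

/-- Partitions without ones whose parts are at most `e`. -/
def noOnes (e : ℕ) (n : ℤ) : ℤ := partCount (fun s => s.count 1 = 0 ∧ s.sup ≤ e) n

lemma noOnes_one (n : ℤ) : noOnes 1 n = if n = 0 then 1 else 0 := by
  have key : ∀ s : Multiset ℕ, 0 ∉ s → s.count 1 = 0 → s.sup ≤ 1 → s = 0 := by
    intro s h0 h1 h2
    refine Multiset.eq_zero_of_forall_notMem fun x hx => ?_
    have hx1 : x ≤ 1 := (Multiset.le_sup hx).trans h2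
    interval_cases x
    · exact h0 hx
    · exact Multiset.count_eq_zero.1 h1 hx
  split_ifs with h
  · subst h
    rw [noOnes, partCount]
    have : {s : Multiset ℕ | 0 ∉ s ∧ (s.sum : ℤ) = 0 ∧ s.count 1 = 0 ∧ s.sup ≤ 1} = {0} := by
      ext s
      constructor
      · rintro ⟨h0, -, h1, h2⟩
        exact key s h0 h1 h2
      · rintro rfl
        simp
    rw [this]
    simp
  · refine partCount_eq_zero fun s h0 hs ⟨h1, h2⟩ => h ?_
    rw [key s h0 h1 h2] at hs
    simpa using hs.symm

lemma partCount_noOnes_sup_eq (e : ℕ) (n : ℤ) :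
    partCount (fun s => s.count 1 = 0 ∧ s.sup = e + 2) n = noOnes (e + 2) (n - (e + 2)) := by
  refine partCount_bij (fun s => s.erase (e + 2)) (fun s => (e + 2) ::ₘ s) ?_ ?_
  · rintro s h0 hs ⟨h1, h2⟩
    have hm : e + 2 ∈ s := by
      rw [← h2]
      refine sup_mem fun h => ?_
      rw [h] at h2
      simp at h2
    have hsum : e + 2 + (s.erase (e + 2)).sum = s.sum := by
      rw [← Multiset.sum_cons, Multiset.cons_erase hm]
    refine ⟨fun h => h0 (Multiset.mem_of_mem_erase h), by omega, ⟨?_, ?_⟩,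
      Multiset.cons_erase hm⟩
    · rw [Multiset.count_erase_of_ne (by omega), h1]
    · exact Multiset.sup_le.2 fun x hx => h2 ▸ Multiset.le_sup (Multiset.mem_of_mem_erase hx)
  · rintro s h0 hs ⟨h1, h2⟩
    refine ⟨by simp [h0], ?_, ⟨?_, ?_⟩, Multiset.erase_cons_head _ _⟩
    · rw [Multiset.sum_cons]
      omega
    · rw [Multiset.count_cons_of_ne (by omega), h1]
    · rw [Multiset.sup_cons, sup_eq_left.2 h2]

lemma noOnes_add_two (e : ℕ) (n : ℤ) :
    noOnes (e + 2) n = noOnes (e + 1) n + noOnes (e + 2) (n - (e + 2)) := by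
  rw [← partCount_noOnes_sup_eq, noOnes, partCount_split _ (fun s => s.sup ≤ e + 1)]
  congr 1
  · exact partCount_congr fun s _ _ => by constructor <;> (intro h; constructor <;> omega)
  · exact partCount_congr fun s _ _ => by constructor <;> (intro h; constructor <;> omega)

/-- Partitions with `ω` ones and crank `e - ω`, corrected at `n = 1`. -/
def crankCell (ω e : ℕ) (n : ℤ) : ℤ :=
  partCount (fun s => s.count 1 = ω ∧ msCrank s = e - ω) n
    + if ω = 0 ∧ n = 1 then (if e = 1 then 1 else 0) - (if e = 0 then 1 else 0) else 0

lemma crankCell_of_neg (ω e : ℕ) {n : ℤ} (hn : n < 0) : crankCell ω e n = 0 := by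
  rw [crankCell, partCount_of_neg _ hn, if_neg (by omega), add_zero]

lemma crankCell_of_lt (ω e : ℕ) {n : ℤ} (hn : n < ω) : crankCell ω e n = 0 := by
  rw [crankCell, if_neg, add_zero]
  · refine partCount_eq_zero fun s h0 hs ⟨h1, h2⟩ => ?_
    have h3 := Multiset.count_le_card 1 s
    have h4 := card_le_sum h0
    omega
  · rintro ⟨h, h'⟩
    omega

lemma crankCell_zero_zero (n : ℤ) :
    crankCell 0 0 n = (if n = 0 then 1 else 0) - (if n = 1 then 1 else 0) := by
  have : partCount (fun s => s.count 1 = 0 ∧ msCrank s = (0 : ℕ) - (0 : ℕ)) n = noOnes 1 n := by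
    refine partCount_congr fun s h0 hs => ?_
    constructor
    · rintro ⟨h1, h2⟩
      rw [msCrank, if_pos h1] at h2
      exact ⟨h1, by omega⟩
    · rintro ⟨h1, h2⟩
      refine ⟨h1, ?_⟩
      rw [msCrank, if_pos h1]
      rcases eq_or_ne s 0 with rfl | hne
      · simp
      · have h3 := sup_mem hne
        interval_cases h : s.sup
        · exact absurd h3 h0
        · exact absurd h3 (Multiset.count_eq_zero.1 h1)
  rw [crankCell, this, noOnes_one]
  by_cases h : n = 1 <;> simp [h]

lemma crankCell_zero_left (e : ℕ) (n : ℤ) :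
    crankCell 0 (e + 1) n = noOnes (e + 1) (n - (e + 1)) := by
  have h : partCount (fun s => s.count 1 = 0 ∧ msCrank s = (e + 1 : ℕ) - (0 : ℕ)) n
      = partCount (fun s => s.count 1 = 0 ∧ s.sup = e + 1) n := by
    refine partCount_congr fun s _ _ => and_congr_right fun h1 => ?_
    rw [msCrank, if_pos h1]
    omega
  rw [crankCell, h]
  cases e with
  | zero =>
    rw [noOnes_one, partCount_eq_zero]
    · by_cases h : n = 1 <;> simp [h, sub_eq_zero]
    · rintro s h0 hs ⟨h1, h2⟩
      have hm : s.sup ∈ s := sup_mem fun h => by simp [h] at h2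
      rw [h2] at hm
      exact Multiset.count_eq_zero.1 h1 hm
  | succ e =>
    rw [partCount_noOnes_sup_eq e n]
    simp
    congr 1

lemma crankCell_succ_eq (ω e : ℕ) (n : ℤ) :
    crankCell (ω + 1) e n =
      partCount (fun s => s.count 1 = ω + 1 ∧ (s.filter (ω + 1 < ·)).card = e) n := by
  rw [crankCell, if_neg (by omega), add_zero]
  refine partCount_congr fun s _ _ => and_congr_right fun h1 => ?_
  rw [msCrank, if_neg (by omega), h1]
  omega

lemma crankCell_zero_right (ω : ℕ) (n : ℤ) :
    crankCell (ω + 1) 0 n = noOnes (ω + 1) (n - (ω + 1)) := by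
  rw [crankCell_succ_eq]
  have h1 (s : Multiset ℕ) :
      s.filter (· ≠ 1) + Multiset.replicate (s.count 1) 1 = s := by
    rw [← Multiset.filter_eq', add_comm]
    exact Multiset.filter_add_not _ _
  refine partCount_bij (fun s => s.filter (· ≠ 1))
    (fun s => s + Multiset.replicate (ω + 1) 1) ?_ ?_
  · rintro s h0 hs ⟨h2, h3⟩
    have h4 := congrArg Multiset.sum (h1 s)
    rw [Multiset.sum_add, Multiset.sum_replicate, h2] at h4
    refine ⟨fun h => h0 (Multiset.mem_of_mem_filter h), ?_, ⟨?_, ?_⟩, ?_⟩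
    · simp only [smul_eq_mul, mul_one] at h4
      omega
    · simp
    · refine Multiset.sup_le.2 fun x hx => ?_
      rw [Multiset.card_eq_zero, Multiset.filter_eq_nil] at h3
      have := h3 x (Multiset.mem_of_mem_filter hx)
      omega
    · conv_rhs => rw [← h1 s, h2]
  · rintro s h0 hs ⟨h2, h3⟩
    refine ⟨by simp [h0, Multiset.mem_replicate], ?_, ⟨?_, ?_⟩, ?_⟩
    · simp only [Multiset.sum_add, Multiset.sum_replicate, smul_eq_mul, mul_one]
      omega
    · simp [h2]
    · rw [Multiset.card_eq_zero, Multiset.filter_eq_nil]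
      intro x hx
      rcases Multiset.mem_add.1 hx with hx | hx
      · have := (Multiset.le_sup hx).trans h3
        omega
      · have := Multiset.eq_of_mem_replicate hx
        omega
    · rw [Multiset.filter_add, Multiset.filter_eq_self.2, Multiset.filter_eq_nil.2, add_zero]
      · intro x hx
        simpa using Multiset.eq_of_mem_replicate hx
      · exact fun x hx h => Multiset.count_eq_zero.1 h2 (h ▸ hx)

/-- Increase every part larger than `k` by one. -/
def raise (k : ℕ) (s : Multiset ℕ) : Multiset ℕ := s.map fun x => if k < x then x + 1 else x

/-- Decrease every part larger than `k` by one. -/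
def lower (k : ℕ) (s : Multiset ℕ) : Multiset ℕ := s.map fun x => if k < x then x - 1 else x

lemma sum_raise (k : ℕ) (s : Multiset ℕ) :
    (raise k s).sum = s.sum + (s.filter (k < ·)).card := by
  induction s using Multiset.induction_on with
  | empty => simp [raise]
  | cons a s ih =>
    unfold raise at ih ⊢
    by_cases h : k < a
    · simp [h, ih]; omega
    · simp [h, ih]; omega

lemma lower_raise (k : ℕ) (s : Multiset ℕ) : lower k (raise k s) = s := by
  rw [lower, raise, Multiset.map_map]
  conv_rhs => rw [← Multiset.map_id s]
  refine Multiset.map_congr rfl fun x _ => ?_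
  simp only [Function.comp, id]
  split_ifs <;> omega

lemma raise_lower {k : ℕ} {s : Multiset ℕ} (h : k + 1 ∉ s) : raise k (lower k s) = s := by
  rw [lower, raise, Multiset.map_map]
  conv_rhs => rw [← Multiset.map_id s]
  refine Multiset.map_congr rfl fun x hx => ?_
  have : x ≠ k + 1 := fun h' => h (h' ▸ hx)
  simp only [Function.comp, id]
  split_ifs <;> omega

lemma card_filter_raise (k : ℕ) (s : Multiset ℕ) :
    ((raise k s).filter (k < ·)).card = (s.filter (k < ·)).card := by
  induction s using Multiset.induction_on with
  | empty => simp [raise]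
  | cons a s ih =>
    unfold raise at ih ⊢
    by_cases h : k < a
    · have h' : k < a + 1 := by omega
      simp [h, h', ih]
    · simp [h, ih]

lemma count_one_raise {k : ℕ} (hk : 1 ≤ k) (s : Multiset ℕ) :
    (raise k s).count 1 = s.count 1 := by
  induction s using Multiset.induction_on with
  | empty => simp [raise]
  | cons a s ih =>
    unfold raise at ih ⊢
    rw [Multiset.map_cons, Multiset.count_cons, Multiset.count_cons, ih]
    congr 1
    split_ifs <;> omega

lemma notMem_raise (k : ℕ) (s : Multiset ℕ) : k + 1 ∉ raise k s := by
  intro h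
  obtain ⟨x, -, hx⟩ := Multiset.mem_map.1 h
  split_ifs at hx <;> omega

lemma zero_notMem_raise {k : ℕ} {s : Multiset ℕ} (h : 0 ∉ s) : 0 ∉ raise k s := by
  intro h'
  obtain ⟨x, hx, hx'⟩ := Multiset.mem_map.1 h'
  split_ifs at hx'
  exact h (hx' ▸ hx)

lemma zero_notMem_lower {k : ℕ} (hk : 1 ≤ k) {s : Multiset ℕ} (h : 0 ∉ s) : 0 ∉ lower k s := by
  intro h'
  obtain ⟨x, hx, hx'⟩ := Multiset.mem_map.1 h'
  split_ifs at hx'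
  · omega
  · exact h (hx' ▸ hx)

lemma crankCell_succ_succ (ω e : ℕ) (n : ℤ) :
    crankCell (ω + 1) (e + 1) n
      = crankCell (ω + 1) (e + 1) (n - (e + 1)) + crankCell (ω + 1) e (n - (ω + 2)) := by
  simp only [crankCell_succ_eq]
  rw [partCount_split _ (fun s => ω + 2 ∈ s), add_comm]
  congr 1
  · refine partCount_bij (lower (ω + 1)) (raise (ω + 1)) ?_ ?_
    · rintro s h0 hs ⟨⟨h1, h2⟩, h3⟩
      have h4 := raise_lower h3
      have h5 := sum_raise (ω + 1) (lower (ω + 1) s)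
      have h6 := card_filter_raise (ω + 1) (lower (ω + 1) s)
      have h7 := count_one_raise (k := ω + 1) (by omega) (lower (ω + 1) s)
      rw [h4] at h5 h6 h7
      exact ⟨zero_notMem_lower (by omega) h0, by omega, ⟨by omega, by omega⟩, h4⟩
    · rintro s h0 hs ⟨h1, h2⟩
      have h5 := sum_raise (ω + 1) s
      exact ⟨zero_notMem_raise h0, by omega,
        ⟨⟨by rw [count_one_raise (by omega), h1], by rw [card_filter_raise, h2]⟩,
          notMem_raise _ _⟩, lower_raise _ _⟩
  · refine partCount_bij (fun s => s.erase (ω + 2)) (fun s => (ω + 2) ::ₘ s) ?_ ?_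
    · rintro s h0 hs ⟨⟨h1, h2⟩, hm⟩
      obtain ⟨t, rfl⟩ := Multiset.exists_cons_of_mem hm
      rw [Multiset.count_cons_of_ne (by omega)] at h1
      rw [Multiset.filter_cons_of_pos _ (by omega), Multiset.card_cons] at h2
      rw [Multiset.sum_cons] at hs
      simp only [Multiset.mem_cons, not_or] at h0
      rw [Multiset.erase_cons_head]
      exact ⟨h0.2, by omega, ⟨h1, by omega⟩, rfl⟩
    · rintro s h0 hs ⟨h1, h2⟩
      refine ⟨by simp [h0], ?_, ⟨⟨?_, ?_⟩, Multiset.mem_cons_self _ _⟩,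
        Multiset.erase_cons_head _ _⟩
      · rw [Multiset.sum_cons]
        omega
      · rw [Multiset.count_cons_of_ne (by omega), h1]
      · rw [Multiset.filter_cons_of_pos _ (by omega), Multiset.card_cons, h2]

lemma eq_zero_of_shift {F : ℤ → ℤ} {e : ℤ} (he : 1 ≤ e) (h : ∀ n, F n = F (n - e))
    (hneg : ∀ n < 0, F n = 0) (n : ℤ) : F n = 0 := by
  have key : ∀ (k : ℕ) (n : ℤ), n < k → F n = 0 := by
    intro k
    induction k with
    | zero => intro n hn; exact hneg n (by simpa using hn)
    | succ k ih =>
      intro n hn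
      rw [h]
      exact ih _ (by push_cast at hn; omega)
  exact key (n.toNat + 1) n (by omega)

lemma crankCell_zero_comm (e : ℕ) (n : ℤ) : crankCell e 0 n = crankCell 0 e n := by
  cases e with
  | zero => rfl
  | succ e => rw [crankCell_zero_left, crankCell_zero_right]

lemma crankCell_zero_succ (e : ℕ) (n : ℤ) :
    crankCell 0 (e + 1) n = crankCell 0 (e + 1) (n - (e + 1)) + crankCell 0 e (n - 1) := by
  cases e with
  | zero =>
    rw [crankCell_zero_left, crankCell_zero_left, crankCell_zero_zero]
    simp only [zero_add, noOnes_one, Nat.cast_zero]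
    split_ifs
    all_goals omega
  | succ e =>
    simp only [crankCell_zero_left]
    rw [show e + 1 + 1 = e + 2 from rfl, noOnes_add_two]
    push_cast
    rw [add_comm]
    congr 2
    ring

lemma crankCell_succ_right (ω e : ℕ) (n : ℤ) :
    crankCell ω (e + 1) n
      = crankCell ω (e + 1) (n - (e + 1)) + crankCell ω e (n - (ω + 1)) := by
  cases ω with
  | zero =>
    rw [crankCell_zero_succ]
    simp
  | succ ω =>
    rw [crankCell_succ_succ]
    congr 2

lemma crankCell_succ_left (ω e : ℕ) (n : ℤ) :
    crankCell (ω + 1) e n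
      = crankCell (ω + 1) e (n - (ω + 1)) + crankCell ω e (n - (e + 1)) := by
  induction e generalizing n with
  | zero =>
    rw [crankCell_zero_comm, crankCell_zero_comm, crankCell_zero_comm, crankCell_zero_succ]
    simp
  | succ e ih =>
    rw [← sub_eq_zero]
    refine eq_zero_of_shift (F := fun n => crankCell (ω + 1) (e + 1) n
      - (crankCell (ω + 1) (e + 1) (n - (ω + 1)) + crankCell ω (e + 1) (n - ((e + 1 : ℕ) + 1))))
      (e := e + 1) (by omega) ?_ ?_ n
    · intro n
      have h1 := crankCell_succ_right (ω + 1) e n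
      have h2 := crankCell_succ_right (ω + 1) e (n - (ω + 1))
      have h3 := crankCell_succ_right ω e (n - ((e + 1 : ℕ) + 1))
      have h4 := ih (n - ((ω + 1 : ℕ) + 1))
      rw [show n - (ω + 1) - ((ω + 1 : ℕ) + 1) = n - ((ω + 1 : ℕ) + 1) - (ω + 1) by ring,
        show n - (ω + 1) - (e + 1) = n - (e + 1) - ((ω : ℤ) + 1) by ring] at h2
      rw [show n - ((e + 1 : ℕ) + 1) - ((ω : ℤ) + 1) = n - ((ω + 1 : ℕ) + 1) - (e + 1) by
        push_cast; ring, show n - ((e + 1 : ℕ) + 1) - ((e : ℤ) + 1)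
          = n - (e + 1) - ((e + 1 : ℕ) + 1) by ring] at h3
      linarith
    · intro n hn
      rw [crankCell_of_neg _ _ hn, crankCell_of_neg _ _ (by omega),
        crankCell_of_neg _ _ (by omega)]
      simp

lemma crankCell_comm (ω e : ℕ) (n : ℤ) : crankCell ω e n = crankCell e ω n := by
  induction e generalizing n with
  | zero => exact crankCell_zero_comm ω n
  | succ e ih =>
    rw [← sub_eq_zero]
    refine eq_zero_of_shift (F := fun n => crankCell ω (e + 1) n - crankCell (e + 1) ω n)
      (e := e + 1) (by omega) ?_ ?_ n
    · intro n
      rw [crankCell_succ_right, crankCell_succ_left e ω n, ih]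
      ring
    · intro n hn
      rw [crankCell_of_neg _ _ hn, crankCell_of_neg _ _ hn, sub_zero]

/-- The crank count at an integer argument. -/
def crankNum (m n : ℤ) : ℤ :=
  partCount (fun s => msCrank s = m) n
    + if n = 1 then (if m = 1 then 1 else 0) - (if m = 0 then 1 else 0) else 0

/-- Sorting partitions by the number of ones. -/
lemma partCount_eq_sum_count_one (P : Multiset ℕ → Prop) {n : ℤ} {W : ℕ} (hW : n < W) :
    partCount P n = ∑ ω ∈ range W, partCount (fun s => s.count 1 = ω ∧ P s) n := by
  have key : ∀ V : ℕ, partCount P n = ∑ ω ∈ range V, partCount (fun s => s.count 1 = ω ∧ P s) n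
      + partCount (fun s => V ≤ s.count 1 ∧ P s) n := by
    intro V
    induction V with
    | zero => simp
    | succ V ih =>
      rw [ih, sum_range_succ, add_assoc]
      congr 1
      rw [partCount_split _ (fun s => s.count 1 = V)]
      congr 1
      · exact partCount_congr fun s _ _ => by
          constructor
          · rintro ⟨⟨-, h⟩, h'⟩; exact ⟨h', h⟩
          · rintro ⟨h, h'⟩; exact ⟨⟨h.ge, h'⟩, h⟩
      · exact partCount_congr fun s _ _ => by
          constructor
          · rintro ⟨⟨h, h'⟩, h''⟩; exact ⟨by omega, h'⟩
          · rintro ⟨h, h'⟩; exact ⟨⟨by omega, h'⟩, by omega⟩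
  rw [key W, add_eq_left]
  refine partCount_eq_zero fun s h0 hs ⟨h1, _⟩ => ?_
  have h3 := Multiset.count_le_card 1 s
  have h4 := card_le_sum h0
  omega

lemma crankNum_natCast (d : ℕ) {n : ℤ} {W : ℕ} (hW : n < W) :
    crankNum d n = ∑ ω ∈ range W, crankCell ω (ω + d) n := by
  rw [crankNum, partCount_eq_sum_count_one _ hW]
  simp only [crankCell, sum_add_distrib]
  congr 1
  · refine sum_congr rfl fun ω _ => partCount_congr fun s _ _ => ?_
    push_cast
    rw [add_sub_cancel_left]
  · by_cases h : n = 1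
    · have : 0 ∈ range W := mem_range.2 (by omega)
      rw [sum_eq_single_of_mem 0 this]
      · simp [h]
      · intro b _ hb
        simp [hb]
    · simp [h]

lemma crankNum_neg_natCast (d : ℕ) {n : ℤ} {W : ℕ} (hW : n < W) (hd : 0 < d) :
    crankNum (-d) n = ∑ e ∈ range W, crankCell (e + d) e n := by
  have h0 : ∑ ω ∈ range d, partCount (fun s => s.count 1 = ω ∧ msCrank s = -d) n = 0 := by
    refine sum_eq_zero fun ω hω => partCount_eq_zero ?_
    rintro s - - ⟨h1, h2⟩
    have := mem_range.1 hω
    unfold msCrank at h2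
    split_ifs at h2 <;> omega
  rw [crankNum, partCount_eq_sum_count_one (W := d + W) _ (by push_cast; omega), sum_range_add,
    h0, if_neg (by omega : ¬ (-(d : ℤ) = 1)), if_neg (by omega : ¬ (-(d : ℤ) = 0))]
  simp only [sub_zero, ite_self, add_zero, zero_add]
  refine sum_congr rfl fun e _ => ?_
  rw [crankCell, if_neg (by omega), add_zero, add_comm e d]
  refine partCount_congr fun s _ _ => ?_
  push_cast
  rw [show (e : ℤ) - (d + e) = -d by ring]

lemma crankNum_neg (m n : ℤ) : crankNum (-m) n = crankNum m n := by
  wlog hm : 0 < m generalizing m with H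
  · rcases eq_or_lt_of_le (not_lt.1 hm) with rfl | h
    · rfl
    · rw [← H (-m) (by omega), neg_neg]
  lift m to ℕ using hm.le
  have hW : n < (n.toNat + 1 : ℕ) := by omega
  rw [crankNum_natCast m hW, crankNum_neg_natCast m hW (by exact_mod_cast hm)]
  exact sum_congr rfl fun e _ => crankCell_comm _ _ _

lemma crankNum_rec (d : ℕ) (n : ℤ) :
    crankNum (d + 1) n - crankNum d (n - 1)
      = crankNum (d + 1) (n - (d + 1)) - crankNum (d + 2) (n - (d + 2)) := by
  obtain ⟨W, hW⟩ : ∃ W : ℕ, n < W := ⟨n.toNat + 1, by omega⟩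
  have h1 := crankNum_natCast (d + 1) (n := n) (W := W + 1) (by push_cast; omega)
  have h2 := crankNum_natCast d (n := n - 1) (W := W + 1) (by push_cast; omega)
  have h3 := crankNum_natCast (d + 1) (n := n - (d + 1)) (W := W + 1) (by push_cast; omega)
  have h4 := crankNum_natCast (d + 2) (n := n - (d + 2)) (W := W + 1) (by push_cast; omega)
  push_cast at h1 h2 h3 h4
  rw [h1, h2, h3, h4, ← sub_eq_zero]
  have key : ∀ V : ℕ, ∑ ω ∈ range (V + 1), crankCell ω (ω + (d + 1)) n
      - ∑ ω ∈ range (V + 1), crankCell ω (ω + d) (n - 1)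
      - (∑ ω ∈ range (V + 1), crankCell ω (ω + (d + 1)) (n - (d + 1))
        - ∑ ω ∈ range (V + 1), crankCell ω (ω + (d + 2)) (n - (d + 2)))
      = crankCell V (V + (d + 2)) (n - (d + 2)) := by
    intro V
    induction V with
    | zero =>
      simp only [zero_add, sum_range_one]
      have := crankCell_succ_right 0 d n
      simp only [Nat.cast_zero, zero_add] at this
      linarith
    | succ V ih =>
      rw [sum_range_succ, sum_range_succ _ (V + 1), sum_range_succ _ (V + 1),
        sum_range_succ _ (V + 1)]
      have h5 := crankCell_succ_right (V + 1) (V + 1 + d) (n + (V + 1))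
      have h6 := crankCell_succ_left V (V + (d + 2)) (n + (V + 1))
      push_cast at h5 h6
      rw [show n + ((V : ℤ) + 1) - (V + 1 + d + 1) = n - (d + 1) by ring,
        show n + ((V : ℤ) + 1) - (V + 1 + 1) = n - 1 by ring] at h5
      rw [show n + ((V : ℤ) + 1) - (V + (d + 2) + 1) = n - (d + 2) by ring,
        show n + ((V : ℤ) + 1) - (V + 1) = n by ring] at h6
      rw [show V + 1 + d + 1 = V + 1 + (d + 1) by ring] at h5
      rw [show V + (d + 2) = V + 1 + (d + 1) by ring] at h6 ih
      linarith
  rw [key, crankCell_of_lt _ _ (by omega)]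

/-- The number of partitions with crank at least `s`, corrected at `n = 1`. -/
def crankGe (s n : ℤ) : ℤ :=
  partCount (fun x => s ≤ msCrank x) n + if n = 1 ∧ s = 1 then 1 else 0

/-- The number of all partitions of an integer. -/
def partNum (n : ℤ) : ℤ := partCount (fun _ => True) n

lemma partCount_add_not (P : Multiset ℕ → Prop) (n : ℤ) :
    partCount P n + partCount (fun s => ¬ P s) n = partNum n := by
  rw [partNum, partCount_split (fun _ => True) P]
  simp only [true_and]

lemma crankGe_of_neg (s : ℤ) {n : ℤ} (hn : n < 0) : crankGe s n = 0 := by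
  rw [crankGe, partCount_of_neg _ hn, if_neg (by omega), add_zero]

lemma abs_msCrank_le {s : Multiset ℕ} (h0 : 0 ∉ s) : |msCrank s| ≤ s.sum := by
  have h1 := Multiset.count_le_card 1 s
  have h2 := card_le_sum h0
  have h3 := Multiset.card_le_card (Multiset.filter_le (fun x => s.count 1 < x) s)
  have h4 := sup_le_sum s
  rw [abs_le, msCrank]
  split_ifs <;> constructor <;> omega

lemma crankGe_of_lt {s n : ℤ} (hn : n < s) : crankGe s n = 0 := by
  rw [crankGe, if_neg (by omega), add_zero]
  refine partCount_eq_zero fun x h0 hx h => ?_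
  have := (abs_le.1 (abs_msCrank_le h0)).2
  omega

lemma crankGe_sub (s n : ℤ) : crankGe s n - crankGe (s + 1) n = crankNum s n := by
  rw [crankGe, crankGe, crankNum, partCount_split _ (fun x => msCrank x = s)]
  have h1 : partCount (fun x => s ≤ msCrank x ∧ msCrank x = s) n
      = partCount (fun x => msCrank x = s) n :=
    partCount_congr fun x _ _ => by constructor <;> intro h <;> omega
  have h2 : partCount (fun x => s ≤ msCrank x ∧ ¬ msCrank x = s) n
      = partCount (fun x => s + 1 ≤ msCrank x) n :=
    partCount_congr fun x _ _ => by constructor <;> intro h <;> omega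
  rw [h1, h2]
  have h3 : (s + 1 = 1) ↔ s = 0 := by omega
  simp only [h3]
  split_ifs <;> omega

lemma crankGe_succ_sub (s : ℕ) (n : ℤ) :
    crankGe (s + 1) n - crankGe s (n - 1) = crankNum (s + 1) (n - (s + 1)) := by
  have key : ∀ k s : ℕ, n < s + k → crankGe (s + 1) n - crankGe s (n - 1)
      = crankNum (s + 1) (n - (s + 1)) := by
    intro k
    induction k with
    | zero =>
      intro s hs
      rw [crankGe_of_lt (by omega), crankNum,
        partCount_of_neg _ (by push_cast at hs; omega), if_neg (by push_cast at hs; omega)]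
      rcases Nat.eq_zero_or_pos s with rfl | h
      · rw [crankGe_of_neg _ (by push_cast at hs; omega)]
        simp
      · rw [crankGe_of_lt (by push_cast at hs; omega)]
        simp
    | succ k ih =>
      intro s hs
      have h1 := ih (s + 1) (by push_cast at hs ⊢; omega)
      have h2 := crankGe_sub (s + 1) n
      have h3 := crankGe_sub s (n - 1)
      have h4 := crankNum_rec s n
      push_cast at h1
      rw [show (s : ℤ) + 1 + 1 = s + 2 by ring] at h1 h2
      linarith
  exact key (n.toNat + 1) s (by push_cast; omega)

lemma crankGe_neg_add (t : ℕ) (n : ℤ) : crankGe (-t) n + crankGe (t + 1) n = partNum n := by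
  have key : ∀ k t : ℕ, n < t + k → crankGe (-t) n + crankGe (t + 1) n = partNum n := by
    intro k
    induction k with
    | zero =>
      intro t ht
      push_cast at ht
      rw [crankGe_of_lt (s := t + 1) (by omega), add_zero, crankGe,
        if_neg (by omega), add_zero]
      refine partCount_congr fun x h0 hx => ?_
      have := (abs_le.1 (abs_msCrank_le h0)).1
      exact iff_of_true (by omega) trivial
    | succ k ih =>
      intro t ht
      have h1 := ih (t + 1) (by push_cast at ht ⊢; omega)
      have h2 := crankGe_sub (-(t + 1)) n
      have h3 := crankGe_sub (t + 1) n
      rw [crankNum_neg, show -((t : ℤ) + 1) + 1 = -t by ring] at h2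
      push_cast at h1
      linarith
  exact key (n.toNat + 1) t (by push_cast; omega)

lemma crankGe_add_of_nonneg (s : ℕ) (n : ℤ) :
    crankGe s (n + s) + crankGe (s + 1) n = partNum n := by
  induction s with
  | zero => simpa using crankGe_neg_add 0 n
  | succ s ih =>
    have h1 := crankGe_succ_sub s (n + (s + 1))
    have h2 := crankGe_sub (s + 1) n
    rw [show n + ((s : ℤ) + 1) - 1 = n + s by ring, add_sub_cancel_right] at h1
    push_cast
    linarith

lemma crankGe_add (s n : ℤ) : crankGe s (n + s) + crankGe (s + 1) n = partNum n := by
  rcases le_total 0 s with hs | hs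
  · lift s to ℕ using hs
    exact crankGe_add_of_nonneg s n
  · obtain ⟨t, rfl⟩ : ∃ t : ℕ, s = -t := ⟨s.natAbs, by omega⟩
    rcases t with _ | t
    · exact crankGe_add_of_nonneg 0 n
    · have h1 := crankGe_neg_add (t + 1) (n + -((t + 1 : ℕ) : ℤ))
      have h2 := crankGe_neg_add t n
      have h3 := crankGe_add_of_nonneg (t + 1) (n + -((t + 1 : ℕ) : ℤ))
      rw [neg_add_cancel_right] at h3
      push_cast at h1 h2 h3 ⊢
      rw [show -((t : ℤ) + 1) + 1 = -t by ring]
      linarith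

/-- Partitions into parts not divisible by three. -/
def regThree (n : ℤ) : ℤ := partCount (fun s => ∀ x ∈ s, ¬ 3 ∣ x) n

/-- The number of partitions with rank at least `s`. -/
def rankGe (s n : ℤ) : ℤ := partCount (fun x => s ≤ msRank x) n

lemma rankGe_add {r : ℤ} (h1 : r ≠ 1) (h2 : r ≠ -1) (n : ℤ) :
    rankGe (r - 1) (n + r) + rankGe (r + 2) n = partNum n := by
  rw [rankGe, ← partCount_dyson h1 h2, ← partCount_add_not (fun s => msRank s ≤ r + 1) n]
  congr 1
  exact partCount_congr fun s _ _ => by omega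

lemma partCount_mul_regThree (k n : ℤ) :
    partCount (fun s => ((s.filter (3 ∣ ·)).sum : ℤ) = 3 * k) n
      = partNum k * regThree (n - 3 * k) := by
  unfold partNum regThree partCount
  rw [← Nat.cast_mul, ← Set.ncard_prod]
  congr 1
  have hcancel (s : Multiset ℕ) :
      ((s.filter (3 ∣ ·)).map (· / 3)).map (3 * ·) = s.filter (3 ∣ ·) := by
    rw [Multiset.map_map]
    conv_rhs => rw [← Multiset.map_id (s.filter (3 ∣ ·))]
    exact Multiset.map_congr rfl fun x hx =>
      Nat.mul_div_cancel' (Multiset.mem_filter.1 hx).2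
  have hsum (s : Multiset ℕ) : (s.filter (3 ∣ ·)).sum + (s.filter (¬ 3 ∣ ·)).sum = s.sum := by
    rw [← Multiset.sum_add, Multiset.filter_add_not]
  refine Set.ncard_congr
    (fun s _ => ((s.filter (3 ∣ ·)).map (· / 3), s.filter (¬ 3 ∣ ·))) ?_ ?_ ?_
  · rintro s ⟨h0, hs, hk⟩
    refine ⟨⟨?_, ?_, trivial⟩, fun h => h0 (Multiset.mem_of_mem_filter h), ?_,
      fun x hx => (Multiset.mem_filter.1 hx).2⟩
    · intro h
      obtain ⟨x, hx, hx'⟩ := Multiset.mem_map.1 h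
      obtain ⟨hx1, c, rfl⟩ := Multiset.mem_filter.1 hx
      have : c = 0 := by omega
      exact h0 (by simpa [this] using hx1)
    · have := congrArg Multiset.sum (hcancel s)
      rw [Multiset.sum_map_mul_left, Multiset.map_id'] at this
      dsimp only
      omega
    · have := hsum s
      dsimp only
      omega
  · rintro s s' ⟨-, -, -⟩ ⟨-, -, -⟩ h
    obtain ⟨h1, h2⟩ := Prod.mk.inj h
    rw [← Multiset.filter_add_not (3 ∣ ·) s, ← Multiset.filter_add_not (3 ∣ ·) s',
      ← hcancel s, ← hcancel s', h1, h2]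
  · rintro ⟨a, b⟩ ⟨⟨ha0, ha, -⟩, hb0, hb, hb3⟩
    have hf1 : (a.map (3 * ·) + b).filter (3 ∣ ·) = a.map (3 * ·) := by
      rw [Multiset.filter_add, Multiset.filter_eq_self.2, Multiset.filter_eq_nil.2, add_zero]
      · exact hb3
      · intro x hx
        obtain ⟨y, -, rfl⟩ := Multiset.mem_map.1 hx
        exact dvd_mul_right 3 y
    have hf2 : (a.map (3 * ·) + b).filter (¬ 3 ∣ ·) = b := by
      rw [Multiset.filter_add, Multiset.filter_eq_nil.2, Multiset.filter_eq_self.2, zero_add]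
      · exact hb3
      · intro x hx
        obtain ⟨y, -, rfl⟩ := Multiset.mem_map.1 hx
        exact not_not.2 (dvd_mul_right 3 y)
    have hsa : (a.map (3 * ·)).sum = 3 * a.sum := by
      rw [Multiset.sum_map_mul_left, Multiset.map_id']
    refine ⟨a.map (3 * ·) + b, ⟨?_, ?_, ?_⟩, ?_⟩
    · simp [ha0, hb0]
    · rw [Multiset.sum_add, hsa]
      dsimp only at ha hb
      omega
    · dsimp only at ha ⊢
      rw [hf1, hsa]
      omega
    · simp only [hf1, hf2, Multiset.map_map]
      congr 1
      conv_rhs => rw [← Multiset.map_id a]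
      exact Multiset.map_congr rfl fun x _ => by simp

lemma partCount_eq_sum_fiber (f : Multiset ℕ → ℤ) (n : ℤ) (I : Finset ℤ)
    (hI : ∀ s : Multiset ℕ, 0 ∉ s → (s.sum : ℤ) = n → f s ∈ I) :
    partNum n = ∑ k ∈ I, partCount (fun s => f s = k) n := by
  have key : ∀ J : Finset ℤ,
      partCount (fun s => f s ∈ J) n = ∑ k ∈ J, partCount (fun s => f s = k) n := by
    intro J
    induction J using Finset.induction_on with
    | empty => exact partCount_eq_zero fun s _ _ => by simp
    | insert a J ha ih =>
      rw [sum_insert ha, ← ih, partCount_split _ (fun s => f s = a)]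
      congr 1
      · exact partCount_congr fun s _ _ => by simp +contextual
      · refine partCount_congr fun s _ _ => ?_
        rw [mem_insert]
        constructor
        · tauto
        · intro h
          exact ⟨Or.inr h, fun h' => ha (h' ▸ h)⟩
  rw [← key]
  exact partCount_congr fun s h0 hs => iff_of_true trivial (hI s h0 hs)

lemma regThree_of_neg {n : ℤ} (hn : n < 0) : regThree n = 0 := partCount_of_neg _ hn

lemma finite_support_conv {g : ℤ → ℤ} {a : ℤ} (hg : ∀ k < a, g k = 0) (n : ℤ) :
    (Function.support fun k => g k * regThree (n - 3 * k)).Finite := by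
  refine (Set.finite_Icc a |n|).subset fun k hk => ?_
  rw [Function.mem_support] at hk
  constructor
  · by_contra h
    exact hk (by rw [hg k (not_le.1 h), zero_mul])
  · by_contra h
    refine hk ?_
    rw [regThree_of_neg, mul_zero]
    have := le_abs_self n
    have := abs_nonneg n
    omega

lemma partNum_eq_finsum (n : ℤ) : partNum n = ∑ᶠ k, partNum k * regThree (n - 3 * k) := by
  rw [finsum_eq_sum_of_support_subset (s := Icc 0 |n|), partCount_eq_sum_fiber
    (fun s => (((s.filter (3 ∣ ·)).sum / 3 : ℕ) : ℤ)) n (Icc 0 |n|)]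
  · refine sum_congr rfl fun k _ => ?_
    rw [← partCount_mul_regThree]
    refine partCount_congr fun s _ _ => ?_
    have : 3 ∣ (s.filter (3 ∣ ·)).sum :=
      Multiset.dvd_sum fun x hx => (Multiset.mem_filter.1 hx).2
    omega
  · intro s _ hs
    have h1 : (s.filter (3 ∣ ·)).sum + (s.filter (¬ 3 ∣ ·)).sum = s.sum := by
      rw [← Multiset.sum_add, Multiset.filter_add_not]
    have := le_abs_self n
    rw [mem_Icc]
    omega
  · intro k hk
    rw [Function.mem_support] at hk
    rw [coe_Icc]
    constructor
    · by_contra h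
      exact hk (by rw [partNum, partCount_of_neg _ (not_le.1 h), zero_mul])
    · by_contra h
      refine hk ?_
      rw [regThree_of_neg, mul_zero]
      have := le_abs_self n
      have := abs_nonneg n
      omega

/-- Convolution of the crank counts in `q ^ 3` with the `3`-regular partitions. -/
def crankConv (s n : ℤ) : ℤ := ∑ᶠ k, crankGe s k * regThree (n - 3 * k)

lemma crankConv_of_neg (s : ℤ) {n : ℤ} (hn : n < 0) : crankConv s n = 0 := by
  rw [crankConv, ← finsum_zero (α := ℤ)]
  refine finsum_congr fun k => ?_
  rcases lt_or_ge k 0 with hk | hk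
  · rw [crankGe_of_neg _ hk, zero_mul]
  · rw [regThree_of_neg (by omega), mul_zero]

lemma crankConv_add (s n : ℤ) : crankConv s (n + 3 * s) + crankConv (s + 1) n = partNum n := by
  have h1 : crankConv s (n + 3 * s) = ∑ᶠ k, crankGe s (k + s) * regThree (n - 3 * k) := by
    rw [crankConv, ← finsum_comp_equiv (Equiv.addRight s)]
    refine finsum_congr fun k => ?_
    rw [Equiv.coe_addRight, show n + 3 * s - 3 * (k + s) = n - 3 * k by ring]
  rw [h1, crankConv, ← finsum_add_distrib, partNum_eq_finsum]
  · refine finsum_congr fun k => ?_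
    rw [← add_mul, crankGe_add]
  · exact finite_support_conv (a := -s) (fun k hk => crankGe_of_neg _ (by omega)) n
  · exact finite_support_conv (a := 0) (fun k hk => crankGe_of_neg _ hk) n

lemma crankConv_natCast (s : ℤ) (n : ℕ) :
    crankConv s n = ∑ k ∈ range (n / 3 + 1), crankGe s k * regThree (n - 3 * k) := by
  rw [crankConv, finsum_eq_sum_of_support_subset
    (s := (range (n / 3 + 1)).map Nat.castEmbedding), sum_map]
  · rfl
  · intro k hk
    rw [Function.mem_support] at hk
    have h0 : 0 ≤ k := by
      by_contra h
      exact hk (by rw [crankGe_of_neg _ (not_le.1 h), zero_mul])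
    have h1 : 0 ≤ n - 3 * k := by
      by_contra h
      exact hk (by rw [regThree_of_neg (not_le.1 h), mul_zero])
    lift k to ℕ using h0
    simp only [coe_map, Set.mem_image, mem_coe, mem_range]
    exact ⟨k, by omega, rfl⟩

lemma rankGe_eq_crankConv (j n : ℤ) : rankGe (3 * j - 1) n = crankConv j n := by
  have hrec (j n : ℤ) : rankGe (3 * j - 1) n - crankConv j n
      = -(rankGe (3 * (j + 1) - 1) (n - 3 * j) - crankConv (j + 1) (n - 3 * j)) := by
    have h1 := rankGe_add (r := 3 * j) (by omega) (by omega) (n - 3 * j)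
    have h2 := crankConv_add j (n - 3 * j)
    rw [sub_add_cancel] at h1 h2
    rw [show 3 * (j + 1) - 1 = 3 * j + 2 by ring]
    linarith
  have hpos : ∀ (k : ℕ) (j n : ℤ), 1 ≤ j → n < k →
      rankGe (3 * j - 1) n - crankConv j n = 0 := by
    intro k
    induction k with
    | zero =>
      intro j n _ hn
      rw [rankGe, partCount_of_neg _ (by simpa using hn),
        crankConv_of_neg _ (by simpa using hn), sub_zero]
    | succ k ih =>
      intro j n hj hn
      rw [hrec, ih (j + 1) _ (by omega) (by push_cast at hn; omega), neg_zero]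
  have hall : ∀ (k : ℕ) (j n : ℤ), 1 ≤ j + k → rankGe (3 * j - 1) n - crankConv j n = 0 := by
    intro k
    induction k with
    | zero => exact fun j n hj => hpos (n.toNat + 1) j n (by simpa using hj) (by omega)
    | succ k ih =>
      intro j n hj
      rw [hrec, ih (j + 1) _ (by push_cast at hj; omega), neg_zero]
  exact sub_eq_zero.1 (hall (1 - j).toNat j n (by omega))

/-- The sign `(-1) ^ j`. -/
def altSign (j : ℤ) : ℤ := if j % 2 = 0 then 1 else -1

lemma abs_msRank_le {s : Multiset ℕ} (h0 : 0 ∉ s) : |msRank s| ≤ s.sum := by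
  have h2 := card_le_sum h0
  have h4 := sup_le_sum s
  rw [abs_le, msRank]
  constructor <;> omega

lemma sum_altSign_block {r : ℤ} {n : ℕ} (h : |r| ≤ n) :
    ∑ j ∈ Icc (-(n + 1 : ℤ)) (n + 1),
        altSign j * ((if 3 * j - 1 ≤ r then 1 else 0) - if 3 * (j + 1) - 1 ≤ r then 1 else 0)
      = (if r % 6 = 0 % 6 then 1 else 0) + (if r % 6 = 1 % 6 then 1 else 0)
        + (if r % 6 = 5 % 6 then 1 else 0) - (if r % 6 = 2 % 6 then 1 else 0)
        - (if r % 6 = 3 % 6 then 1 else 0) - (if r % 6 = 4 % 6 then 1 else 0) := by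
  have h' := abs_le.1 h
  rw [sum_eq_single_of_mem ((r + 1) / 3) (by rw [mem_Icc]; omega)]
  · rw [if_pos (by omega), if_neg (by omega), altSign]
    have h6 : r % 6 = 0 ∨ r % 6 = 1 ∨ r % 6 = 2 ∨ r % 6 = 3 ∨ r % 6 = 4 ∨ r % 6 = 5 := by omega
    rcases h6 with h6 | h6 | h6 | h6 | h6 | h6
    · rw [if_pos (by omega), h6]; norm_num
    · rw [if_pos (by omega), h6]; norm_num
    · rw [if_neg (by omega), h6]; norm_num
    · rw [if_neg (by omega), h6]; norm_num
    · rw [if_neg (by omega), h6]; norm_num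
    · rw [if_pos (by omega), h6]; norm_num
  · intro j _ hj
    by_cases h1 : 3 * j - 1 ≤ r
    · rw [if_pos h1, if_pos (by omega), sub_self, mul_zero]
    · rw [if_neg h1, if_neg (by omega), sub_self, mul_zero]

lemma N6_eq_sum_rankGe (n : ℕ) :
    N6 n = ∑ j ∈ Icc (-(n + 1 : ℤ)) (n + 1),
      altSign j * (rankGe (3 * j - 1) n - rankGe (3 * (j + 1) - 1) n) := by
  simp only [rankGe, partCount_natCast, N6, rankCountMod6, Finset.card_filter, Nat.cast_sum,
    ← sum_sub_distrib, ← sum_add_distrib, mul_sum]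
  rw [sum_comm]
  refine sum_congr rfl fun p _ => ?_
  have h : |p.rank| ≤ n := by
    have := abs_msRank_le (s := p.parts) fun h => (p.parts_pos h).ne rfl
    rwa [p.parts_sum] at this
  simp only [Nat.cast_ite, Nat.cast_one, Nat.cast_zero]
  convert (sum_altSign_block h).symm
  all_goals rfl

lemma crankCount_eq_crankNum (m : ℤ) (k : ℕ) : crankCount m k = crankNum m k := by
  have h : ((univ.filter fun p : k.Partition => p.crank = m).card : ℤ)
      = partCount (fun s => msCrank s = m) k := by
    rw [partCount_natCast, Finset.card_filter, Nat.cast_sum]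
    refine sum_congr rfl fun p _ => ?_
    simp only [Nat.cast_ite, Nat.cast_one, Nat.cast_zero]
    rfl
  rw [crankCount, crankNum, h]
  by_cases hk : k = 1
  · subst hk
    have hu : ∀ p : Nat.Partition 1, p.crank = -1 := by
      intro p
      rw [Subsingleton.elim p (Nat.Partition.indiscrete 1), Nat.Partition.crank,
        Nat.Partition.indiscrete_parts one_ne_zero]
      rfl
    rw [← h, if_pos rfl, if_pos Nat.cast_one]
    simp only [hu]
    by_cases h1 : m = -1
    · subst h1
      simp
    · rw [filter_false_of_mem fun _ _ h' => h1 h'.symm, card_empty]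
      split_ifs <;> omega
  · rw [if_neg hk, if_neg (by exact_mod_cast hk), add_zero]

lemma crankNum_eq_zero {m : ℤ} {k : ℕ} (h : (k : ℤ) < |m|) : crankNum m k = 0 := by
  rw [crankNum, partCount_eq_zero, zero_add]
  · have := lt_abs.1 h
    split_ifs <;> omega
  · intro s h0 hs hm
    have := abs_msCrank_le h0
    rw [hm] at this
    omega

lemma M2_eq_sum_crankNum {k n : ℕ} (h : k ≤ n) :
    M2 k = ∑ m ∈ Icc (-(n + 1 : ℤ)) (n + 1), altSign m * crankNum m k := by
  have h1 : M2 k = ∑ m ∈ Icc (-(k : ℤ)) k, altSign m * crankNum m k := by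
    rw [M2, crankCountMod2, crankCountMod2, ← sum_sub_distrib]
    refine sum_congr rfl fun m _ => ?_
    rw [crankCount_eq_crankNum, altSign]
    rcases Int.emod_two_eq_zero_or_one m with h2 | h2 <;> simp [h2]
  rw [h1]
  refine sum_subset (Icc_subset_Icc (by omega) (by omega)) fun m _ hm => ?_
  rw [crankNum_eq_zero, mul_zero]
  by_contra h2
  exact hm (mem_Icc.2 (abs_le.1 (not_lt.1 h2)))

lemma p3_eq_regThree (n : ℕ) : (p3 n : ℤ) = regThree n := by
  rw [p3, regThree, partCount_natCast, Finset.card_filter, Nat.cast_sum]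
  refine sum_congr rfl fun p _ => ?_
  simp only [Nat.cast_ite, Nat.cast_one, Nat.cast_zero]
  exact if_congr (forall₂_congr fun x _ => by omega) rfl rfl

/-- the relation `N₍₆₎(n) = Σ M₍₂₎(k)·p₃(n−3k)`. -/
theorem N6_eq_sum_M2_p3 (n : ℕ) :
    N6 n = ∑ k ∈ Finset.range (n / 3 + 1), M2 k * (p3 (n - 3 * k) : ℤ) := by
  have hR : ∀ k ∈ range (n / 3 + 1), M2 k * (p3 (n - 3 * k) : ℤ)
      = ∑ m ∈ Icc (-(n + 1 : ℤ)) (n + 1),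
        altSign m * (crankNum m k * regThree (n - 3 * k)) := by
    intro k hk
    have hk' := mem_range.1 hk
    rw [M2_eq_sum_crankNum (n := n) (by omega), p3_eq_regThree, sum_mul,
      Nat.cast_sub (by omega)]
    refine sum_congr rfl fun m _ => ?_
    push_cast
    ring
  rw [N6_eq_sum_rankGe, sum_congr rfl hR, sum_comm]
  refine sum_congr rfl fun m _ => ?_
  rw [← mul_sum, rankGe_eq_crankConv, rankGe_eq_crankConv, crankConv_natCast,
    crankConv_natCast, ← sum_sub_distrib]
  congr 1
  refine sum_congr rfl fun k _ => ?_
  rw [← sub_mul, crankGe_sub]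

end
end
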